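/- For every natural number n with 13 ≤ n ≤ 39 there exists a maxnil graph with n vertices and exactly 2n edges. -/

import Mathlib

open SimpleGraph

/-- `H` is a minor of `G`: there is a family of nonempty, pairwise disjoint,
connected branch sets in `G`, one for each vertex of `H`, with an edge of `G`
between the branch sets of any two adjacent vertices of `H`. -/
def IsMinor {W V : Type} (H : SimpleGraph W) (G : SimpleGraph V) : Prop :=
  ∃ f : W → Set V,
    (∀ w, (f w).Nonempty) ∧
    (∀ w, (G.induce (f w)).Connected) ∧
    (Pairwise fun w₁ w₂ => Disjoint (f w₁) (f w₂)) ∧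
    ∀ ⦃w₁ w₂⦄, H.Adj w₁ w₂ → ∃ v₁ ∈ f w₁, ∃ v₂ ∈ f w₂, G.Adj v₁ v₂

/-- The result of a `∇Y`-move on the triangle `a b c` of `G`: delete the edges of
the triangle and add a new vertex (`none`) joined to `a`, `b`, `c`. -/
def triangleY {V : Type} (G : SimpleGraph V) (a b c : V) : SimpleGraph (Option V) :=
  (SimpleGraph.map Function.Embedding.some
      (G.deleteEdges {s(a, b), s(b, c), s(a, c)})) ⊔
    SimpleGraph.fromEdgeSet {s((none : Option V), some a), s(none, some b), s(none, some c)}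

/-- Membership in the Petersen family: the graphs obtained from `K₆` by
`∇Y`-moves and `Y∇`-moves (the inverse operation), up to isomorphism. -/
inductive IsPetersenFamily : ∀ {V : Type}, SimpleGraph V → Prop
  | k6 : IsPetersenFamily (⊤ : SimpleGraph (Fin 6))
  | deltaY {V : Type} {G : SimpleGraph V} {a b c : V} :
      IsPetersenFamily G → G.Adj a b → G.Adj b c → G.Adj a c →
      IsPetersenFamily (triangleY G a b c)
  | yDelta {V : Type} {G : SimpleGraph V} {a b c : V} :
      IsPetersenFamily (triangleY G a b c) → G.Adj a b → G.Adj b c → G.Adj a c →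
      IsPetersenFamily G
  | iso {V W : Type} {G : SimpleGraph V} {H : SimpleGraph W} :
      IsPetersenFamily G → G ≃g H → IsPetersenFamily H

/-- A graph is linklessly embeddable (nIL) iff it has no minor in the Petersen family. -/
def IsLinkless {V : Type} (G : SimpleGraph V) : Prop :=
  ∀ ⦃W : Type⦄ (P : SimpleGraph W), IsPetersenFamily P → ¬ IsMinor P G

/-- The graph obtained from `G` by adding the edge `ab`. -/
def addEdge {V : Type} (G : SimpleGraph V) (a b : V) : SimpleGraph V :=
  G ⊔ SimpleGraph.fromEdgeSet {s(a, b)}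

/-- A nIL graph is maxnil if adding any edge yields a graph that is not nIL. -/
def IsMaxnil {V : Type} (G : SimpleGraph V) : Prop :=
  IsLinkless G ∧ ∀ a b : V, a ≠ b → ¬ G.Adj a b → ¬ IsLinkless (addEdge G a b)

/-- `S` is a vertex cut set of the connected graph `G` if `G - S` is disconnected. -/
def IsVertexCut {V : Type} (G : SimpleGraph V) (S : Set V) : Prop :=
  G.Connected ∧ ¬ (G.induce Sᶜ).Preconnected

/-- A vertex cut set is minimal if no proper subset of it is a vertex cut set. -/
def IsMinimalVertexCut {V : Type} (G : SimpleGraph V) (S : Set V) : Prop :=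
  IsVertexCut G S ∧ ∀ S' ⊂ S, ¬ IsVertexCut G S'

/-- A set `T` of vertices of `H` (inducing a `K₄`) is strongly separating if `H - T`
has at least two connected components such that every vertex of `T` has a
neighbor in each of them. -/
def StronglySeparating {V : Type} (H : SimpleGraph V) (T : Set V) : Prop :=
  ∃ C₁ C₂ : (H.induce Tᶜ).ConnectedComponent, C₁ ≠ C₂ ∧
    ∀ v ∈ T, (∃ u ∈ C₁.supp, H.Adj v ↑u) ∧ (∃ u ∈ C₂.supp, H.Adj v ↑u)

/-- `G` is maximal without a `K₆` minor. -/
def IsMaximalK6MinorFree {V : Type} (G : SimpleGraph V) : Prop :=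
  ¬ IsMinor (⊤ : SimpleGraph (Fin 6)) G ∧
    ∀ a b : V, a ≠ b → ¬ G.Adj a b → IsMinor (⊤ : SimpleGraph (Fin 6)) (addEdge G a b)

/-! ### Part 1: the Petersen family consists of seven explicit graphs -/

def sadj (m a b : ℕ) : Bool := a != b && (m.testBit (10 * a + b) || m.testBit (10 * b + a))

lemma sadj_comm (m a b : ℕ) : sadj m a b = sadj m b a := by
  unfold sadj
  rw [Bool.or_comm, bne_comm]

/-- The graph on `Fin k` coded by the bit mask `m`. -/
def gr (k m : ℕ) : SimpleGraph (Fin k) where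
  Adj a b := sadj m a b = true
  symm := ⟨fun a b h => by rw [sadj_comm]; exact h⟩
  loopless := ⟨fun a h => by simp [sadj] at h⟩

def famL : List (ℕ × ℕ) :=
  [(6, 35235970478142), (7, 35236037648504), (8, 176093785088224), (8, 144256063129116792), (9,
  288406710455189728), (7, 120376639614), (10, 865395228826484960)]

/-- isomorphisms used for the triangle-to-Y moves -/
def tD : List (ℕ × List ℕ) :=
  [(1, [0, 1, 2, 3, 4, 5, 6]), (1, [0, 1, 3, 2, 4, 5, 6]), (1, [0, 1, 3, 4, 2, 5, 6]), (1, [0, 1,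
  3, 4, 5, 2, 6]), (1, [0, 3, 1, 2, 4, 5, 6]), (1, [0, 3, 1, 4, 2, 5, 6]), (1, [0, 3, 1, 4, 5, 2,
  6]), (1, [0, 3, 4, 1, 2, 5, 6]), (1, [0, 3, 4, 1, 5, 2, 6]), (1, [0, 3, 4, 5, 1, 2, 6]), (1, [3,
  0, 1, 2, 4, 5, 6]), (1, [3, 0, 1, 4, 2, 5, 6]), (1, [3, 0, 1, 4, 5, 2, 6]), (1, [3, 0, 4, 1, 2,
  5, 6]), (1, [3, 0, 4, 1, 5, 2, 6]), (1, [3, 0, 4, 5, 1, 2, 6]), (1, [3, 4, 0, 1, 2, 5, 6]), (1,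
  [3, 4, 0, 1, 5, 2, 6]), (1, [3, 4, 0, 5, 1, 2, 6]), (1, [3, 4, 5, 0, 1, 2, 6]), (2, [0, 1, 2, 3,
  4, 5, 6, 7]), (2, [0, 1, 2, 3, 5, 4, 6, 7]), (2, [0, 1, 2, 5, 3, 4, 6, 7]), (2, [1, 0, 2, 3, 4,
  5, 6, 7]), (2, [1, 0, 2, 3, 5, 4, 6, 7]), (2, [1, 0, 2, 5, 3, 4, 6, 7]), (2, [1, 2, 0, 3, 4, 5,
  6, 7]), (2, [1, 2, 0, 3, 5, 4, 6, 7]), (2, [1, 2, 0, 5, 3, 4, 6, 7]), (3, [0, 1, 2, 3, 4, 5, 6,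
  7]), (4, [0, 1, 2, 3, 4, 5, 6, 7, 8]), (4, [0, 1, 2, 4, 3, 5, 6, 7, 8]), (4, [0, 2, 1, 3, 4, 5,
  6, 7, 8]), (4, [0, 2, 1, 4, 3, 5, 6, 7, 8]), (6, [0, 1, 2, 3, 4, 5, 6, 7, 8, 9]), (2, [5, 7, 1,
  2, 6, 3, 4, 0]), (2, [5, 7, 1, 2, 3, 6, 4, 0]), (2, [5, 7, 1, 2, 3, 4, 6, 0]), (2, [5, 1, 7, 2,
  6, 3, 4, 0]), (2, [5, 1, 7, 2, 3, 6, 4, 0]), (2, [5, 1, 7, 2, 3, 4, 6, 0]), (2, [5, 1, 2, 7, 6,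
  3, 4, 0]), (2, [5, 1, 2, 7, 3, 6, 4, 0]), (2, [5, 1, 2, 7, 3, 4, 6, 0])]

/-- isomorphisms used for the Y-to-triangle moves -/
def tY : List (ℕ × List ℕ) :=
  [(0, [0, 1, 2, 3, 4, 5, 0]), (5, [0, 1, 2, 4, 5, 0, 6, 3]), (1, [0, 3, 4, 1, 2, 5, 0, 6]), (1,
  [0, 1, 2, 3, 4, 5, 6, 0]), (1, [3, 4, 5, 0, 1, 2, 0, 6]), (1, [0, 1, 2, 3, 4, 5, 6, 0]), (2, [0,
  7, 1, 6, 3, 5, 4, 2, 0]), (2, [7, 0, 1, 6, 5, 3, 4, 0, 2]), (2, [7, 6, 5, 0, 1, 3, 0, 4, 2]),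
  (2, [1, 3, 5, 0, 2, 4, 0, 6, 7]), (2, [1, 0, 2, 3, 5, 4, 6, 0, 7]), (2, [0, 1, 2, 3, 4, 5, 6, 7,
  0]), (4, [0, 1, 7, 0, 8, 2, 4, 5, 6, 3]), (4, [1, 0, 7, 0, 2, 8, 4, 6, 5, 3]), (4, [1, 7, 0, 2,
  0, 8, 4, 6, 3, 5]), (4, [1, 0, 2, 0, 7, 8, 6, 4, 5, 3]), (4, [1, 2, 0, 7, 0, 8, 6, 4, 3, 5]),
  (4, [2, 1, 0, 7, 8, 0, 6, 3, 4, 5]), (4, [2, 4, 5, 0, 1, 3, 0, 6, 7, 8]), (4, [2, 0, 1, 4, 5, 3,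
  6, 0, 7, 8]), (4, [0, 2, 1, 4, 3, 5, 6, 7, 0, 8]), (4, [0, 1, 2, 3, 4, 5, 6, 7, 8, 0])]

def inT (a b c x : ℕ) : Bool := x == a || x == b || x == c

def triB (k m a b c x y : ℕ) : Bool :=
  if x < k then
    if y < k then sadj m x y && !(inT a b c x && inT a b c y) else inT a b c x
  else if y < k then inT a b c y else false

def okD (k m a b c m' : ℕ) (l : List ℕ) : Bool :=
  (List.range (k + 1)).all fun x => decide (l.getD x 0 < k + 1) &&
    (List.range (k + 1)).all fun y => (x == y || l.getD x 0 != l.getD y 0) &&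
      (triB k m a b c x y == sadj m' (l.getD x 0) (l.getD y 0))

lemma triangleY_ss {V : Type} (G : SimpleGraph V) {a b c : V} (hab : a ≠ b) (hbc : b ≠ c)
    (hac : a ≠ c) (x y : V) : (triangleY G a b c).Adj (some x) (some y) ↔
      G.Adj x y ∧ ¬ ((x = a ∨ x = b ∨ x = c) ∧ (y = a ∨ y = b ∨ y = c)) := by
  simp only [triangleY, sup_adj, map_adj, deleteEdges_adj, fromEdgeSet_adj]
  constructor
  · rintro (⟨u, v, ⟨h1, h2⟩, h3, h4⟩ | ⟨h, _⟩)
    · simp only [Function.Embedding.some_apply, Option.some.injEq] at h3 h4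
      subst h3 h4
      refine ⟨h1, fun h => h2 ?_⟩
      have := h1.ne
      rcases h with ⟨rfl | rfl | rfl, rfl | rfl | rfl⟩ <;> simp_all
    · simp at h
  · rintro ⟨h1, h2⟩
    left
    refine ⟨x, y, ⟨h1, ?_⟩, rfl, rfl⟩
    intro h
    simp only [Set.mem_insert_iff, Set.mem_singleton_iff, Sym2.eq_iff] at h
    apply h2
    tauto

lemma triangleY_ns {V : Type} (G : SimpleGraph V) (a b c : V) (y : V) :
    (triangleY G a b c).Adj none (some y) ↔ (y = a ∨ y = b ∨ y = c) := by
  simp only [triangleY, sup_adj, map_adj, fromEdgeSet_adj]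
  simp

lemma triangleY_sn {V : Type} (G : SimpleGraph V) (a b c : V) (y : V) :
    (triangleY G a b c).Adj (some y) none ↔ (y = a ∨ y = b ∨ y = c) := by
  rw [SimpleGraph.adj_comm, triangleY_ns]

lemma okD_iso {k m a b c m' : ℕ} {l : List ℕ} (h : okD k m a b c m' l = true)
    (ha : a < k) (hb : b < k) (hc : c < k) (hab : a ≠ b) (hbc : b ≠ c) (hac : a ≠ c) :
    Nonempty (triangleY (gr k m) ⟨a, ha⟩ ⟨b, hb⟩ ⟨c, hc⟩ ≃g gr (k + 1) m') := by
  simp only [okD, List.all_eq_true, List.mem_range, Bool.and_eq_true, decide_eq_true_eq,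
    Bool.or_eq_true, beq_iff_eq, bne_iff_ne] at h
  let e : Option (Fin k) → ℕ := fun o => o.elim k (fun x => x.1)
  have he : ∀ o, e o < k + 1 := by
    rintro (_ | x)
    · simp [e]
    · have := x.2
      simp only [e, Option.elim]
      omega
  have hei : ∀ o o', e o = e o' → o = o' := by
    rintro (_ | x) (_ | y) h
    · rfl
    · have := y.2
      simp only [e, Option.elim] at h
      omega
    · have := x.2
      simp only [e, Option.elim] at h
      omega
    · simp only [e, Option.elim] at h
      rw [Fin.ext h]
  let f : Option (Fin k) → Fin (k + 1) := fun o => ⟨l.getD (e o) 0, (h _ (he o)).1⟩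
  have hf : Function.Injective f := by
    intro o o' hoo
    have h1 := ((h _ (he o)).2 _ (he o')).1
    rcases h1 with h1 | h1
    · exact hei _ _ h1
    · exact absurd (congrArg Fin.val hoo) h1
  have hbij : Function.Bijective f :=
    (Fintype.bijective_iff_injective_and_card f).2 ⟨hf, by simp⟩
  refine ⟨⟨Equiv.ofBijective f hbij, ?_⟩⟩
  intro o o'
  have h2 := ((h _ (he o)).2 _ (he o')).2
  change (sadj m' (l.getD (e o) 0) (l.getD (e o') 0) = true) ↔ _
  rw [← h2]
  have h1 : (⟨a, ha⟩ : Fin k) ≠ ⟨b, hb⟩ := by simpa using hab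
  have h3 : (⟨b, hb⟩ : Fin k) ≠ ⟨c, hc⟩ := by simpa using hbc
  have h4 : (⟨a, ha⟩ : Fin k) ≠ ⟨c, hc⟩ := by simpa using hac
  rcases o with _ | x <;> rcases o' with _ | y
  · simp [e, triB]
  · rw [triangleY_ns]
    simp [e, triB, inT, Fin.ext_iff, or_assoc]
  · rw [triangleY_sn]
    simp [e, triB, inT, Fin.ext_iff, or_assoc]
  · rw [triangleY_ss _ h1 h3 h4]
    simp only [e, Option.elim, triB, x.2, y.2, if_true, inT, Bool.and_eq_true, Bool.not_eq_true',
      Fin.ext_iff, gr, ← Bool.not_eq_true, Bool.or_eq_true, beq_iff_eq, or_assoc]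

def yB (m v x y : ℕ) : Bool := sadj m x y || (x != y && sadj m v x && sadj m v y)

def okY (k m v m' : ℕ) (l : List ℕ) : Bool :=
  (List.range (k + 1)).all fun x => x == v || (decide (l.getD x 0 < k) &&
    (List.range (k + 1)).all fun y => y == v || ((x == y || l.getD x 0 != l.getD y 0) &&
      (yB m v x y == sadj m' (l.getD x 0) (l.getD y 0))))

def condY (k m v a b c : ℕ) : Bool :=
  sadj m v a && sadj m v b && sadj m v c && a != b && b != c && a != c &&
  !sadj m a b && !sadj m b c && !sadj m a c &&
  (List.range k).all fun x => !sadj m v x || inT a b c x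

def checkD : Bool := famL.all fun km =>
  (List.range km.1).all fun a => (List.range km.1).all fun b => !sadj km.2 a b ||
  (List.range km.1).all fun c => !(sadj km.2 b c && sadj km.2 a c) ||
    tD.any fun jl => (famL.getD jl.1 (0, 0)).1 == km.1 + 1 &&
      (decide (jl.1 < 7) && okD km.1 km.2 a b c (famL.getD jl.1 (0, 0)).2 jl.2)

def checkY : Bool := famL.all fun km =>
  (List.range km.1).all fun v => (List.range km.1).all fun a => !sadj km.2 v a ||
  (List.range km.1).all fun b => !sadj km.2 v b || (List.range km.1).all fun c =>
    !condY km.1 km.2 v a b c ||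
    tY.any fun jl => (famL.getD jl.1 (0, 0)).1 + 1 == km.1 &&
      (decide (jl.1 < 7) &&
        okY (famL.getD jl.1 (0, 0)).1 km.2 v (famL.getD jl.1 (0, 0)).2 jl.2)

lemma checkD_true : checkD = true := by decide +kernel

lemma checkY_true : checkY = true := by decide +kernel

lemma famL_getD_mem {j : ℕ} (h : j < 7) : famL.getD j (0, 0) ∈ famL := by
  have : j < famL.length := h
  rw [List.getD_eq_getElem _ _ this]
  exact List.getElem_mem _

/-- Being isomorphic to one of the seven explicit graphs. -/
def Fam {V : Type} (G : SimpleGraph V) : Prop := ∃ km ∈ famL, Nonempty (G ≃g gr km.1 km.2)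

lemma Fam.iso {V W : Type} {G : SimpleGraph V} {H : SimpleGraph W} (h : Fam G) (e : G ≃g H) :
    Fam H := by
  obtain ⟨km, hm, ⟨f⟩⟩ := h
  exact ⟨km, hm, ⟨e.symm.trans f⟩⟩

lemma triangleY_congr {V W : Type} {G : SimpleGraph V} {H : SimpleGraph W} (e : G ≃g H)
    {a b c : V} (hab : a ≠ b) (hbc : b ≠ c) (hac : a ≠ c) :
    Nonempty (triangleY G a b c ≃g triangleY H (e a) (e b) (e c)) := by
  refine ⟨⟨Equiv.optionCongr e.toEquiv, ?_⟩⟩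
  have h1 : e a ≠ e b := by simpa using hab
  have h3 : e b ≠ e c := by simpa using hbc
  have h4 : e a ≠ e c := by simpa using hac
  rintro (_ | x) (_ | y)
  · simp
  · simp only [Equiv.optionCongr_apply, Option.map_none, Option.map_some]
    rw [triangleY_ns, triangleY_ns]
    simp
  · simp only [Equiv.optionCongr_apply, Option.map_none, Option.map_some]
    rw [triangleY_sn, triangleY_sn]
    simp
  · simp only [Equiv.optionCongr_apply, Option.map_some]
    rw [triangleY_ss _ h1 h3 h4, triangleY_ss _ hab hbc hac]
    simp [e.map_adj_iff]

lemma Fam.deltaY {V : Type} {G : SimpleGraph V} {a b c : V} (h : Fam G) (hab : G.Adj a b)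
    (hbc : G.Adj b c) (hac : G.Adj a c) : Fam (triangleY G a b c) := by
  obtain ⟨km, hm, ⟨e⟩⟩ := h
  obtain ⟨f⟩ := triangleY_congr e hab.ne hbc.ne hac.ne
  refine Fam.iso ?_ f.symm
  have h1 : sadj km.2 (e a) (e b) = true := e.map_adj_iff.2 hab
  have h2 : sadj km.2 (e b) (e c) = true := e.map_adj_iff.2 hbc
  have h3 : sadj km.2 (e a) (e c) = true := e.map_adj_iff.2 hac
  have hk := checkD_true
  simp only [checkD, List.all_eq_true, List.mem_range] at hk
  have := hk km hm _ (e a).2 _ (e b).2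
  rw [h1] at this
  simp only [Bool.not_true, Bool.false_or, List.all_eq_true, List.mem_range] at this
  have := this _ (e c).2
  rw [h2, h3] at this
  simp only [Bool.and_self, Bool.not_true, Bool.false_or, List.any_eq_true, Bool.and_eq_true,
    beq_iff_eq, decide_eq_true_eq] at this
  obtain ⟨jl, -, h5, h6, h7⟩ := this
  refine ⟨_, famL_getD_mem h6, ?_⟩
  rw [h5]
  refine okD_iso h7 (e a).2 (e b).2 (e c).2 ?_ ?_ ?_
  · intro h; exact hab.ne (e.injective (Fin.ext h))
  · intro h; exact hbc.ne (e.injective (Fin.ext h))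
  · intro h; exact hac.ne (e.injective (Fin.ext h))

lemma Fam.yDelta {V : Type} {G : SimpleGraph V} {a b c : V} (h : Fam (triangleY G a b c))
    (hab : G.Adj a b) (hbc : G.Adj b c) (hac : G.Adj a c) : Fam G := by
  obtain ⟨km, hm, ⟨e⟩⟩ := h
  have hss := triangleY_ss G hab.ne hbc.ne hac.ne
  have hinj : ∀ x y, (e x : ℕ) = e y ↔ x = y := fun x y => by
    rw [Fin.val_inj, e.injective.eq_iff]
  have hadj : ∀ x y, sadj km.2 (e x) (e y) = true ↔ (triangleY G a b c).Adj x y :=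
    fun x y => e.map_adj_iff
  have hc : condY km.1 km.2 (e none) (e (some a)) (e (some b)) (e (some c)) = true := by
    simp only [condY, Bool.and_eq_true, hadj, bne_iff_ne, ne_eq, hinj, Bool.not_eq_true',
      ← Bool.not_eq_true, List.all_eq_true, List.mem_range, Bool.or_eq_true, inT, beq_iff_eq,
      triangleY_ns, hss, Option.some.injEq]
    refine ⟨⟨⟨⟨⟨⟨⟨⟨⟨?_, ?_⟩, ?_⟩, hab.ne⟩, hbc.ne⟩, hac.ne⟩, ?_⟩, ?_⟩, ?_⟩, ?_⟩
    · simp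
    · simp
    · simp
    · simp
    · simp
    · simp
    · intro x hx
      obtain ⟨y, hy⟩ := e.surjective ⟨x, hx⟩
      have hy' : x = (e y : ℕ) := by rw [hy]
      subst hy'
      rw [hadj, hinj, hinj, hinj]
      rcases y with _ | y
      · simp
      · rw [triangleY_ns]
        simp only [Option.some.injEq]
        tauto
  have hk := checkY_true
  simp only [checkY, List.all_eq_true, List.mem_range] at hk
  have h3 := hk km hm _ (e none).2 _ (e (some a)).2
  have ha1 : sadj km.2 (e none) (e (some a)) = true := by rw [hadj, triangleY_ns]; simp
  have hb1 : sadj km.2 (e none) (e (some b)) = true := by rw [hadj, triangleY_ns]; simp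
  rw [ha1] at h3
  simp only [Bool.not_true, Bool.false_or, List.all_eq_true, List.mem_range] at h3
  have h3 := h3 _ (e (some b)).2
  rw [hb1] at h3
  simp only [Bool.not_true, Bool.false_or, List.all_eq_true, List.mem_range] at h3
  have h3 := h3 _ (e (some c)).2
  rw [hc] at h3
  simp only [Bool.not_true, Bool.false_or, List.any_eq_true, Bool.and_eq_true,
    beq_iff_eq, decide_eq_true_eq] at h3
  obtain ⟨jl, -, h5, h6, h7⟩ := h3
  refine ⟨_, famL_getD_mem h6, ?_⟩
  generalize (famL.getD jl.1 (0, 0)) = km' at *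
  simp only [okY, List.all_eq_true, List.mem_range, Bool.and_eq_true, decide_eq_true_eq,
    Bool.or_eq_true, beq_iff_eq, bne_iff_ne] at h7
  have hlt : ∀ x, (e x : ℕ) < km'.1 + 1 := fun x => by rw [h5]; exact (e x).2
  have hne : ∀ x, ¬ ((e (some x) : ℕ) = e none) := fun x => by rw [hinj]; simp
  have h8 := fun x => (h7 _ (hlt (some x))).resolve_left (hne x)
  let f : V → Fin km'.1 := fun x => ⟨jl.2.getD (e (some x)) 0, (h8 x).1⟩
  have h9 := fun x y => ((h8 x).2 _ (hlt (some y))).resolve_left (hne y)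
  have hf : Function.Injective f := by
    intro x y hxy
    rcases (h9 x y).1 with h | h
    · rw [hinj] at h; simpa using h
    · exact absurd (congrArg Fin.val hxy) h
  have : Finite V := Finite.of_injective f hf
  have := Fintype.ofFinite V
  have hcard : Fintype.card V = Fintype.card (Fin km'.1) := by
    have := Fintype.card_congr e.toEquiv
    simp at this
    simp
    omega
  have hbij : Function.Bijective f :=
    (Fintype.bijective_iff_injective_and_card f).2 ⟨hf, hcard⟩
  refine ⟨⟨Equiv.ofBijective f hbij, ?_⟩⟩
  intro x y
  change (sadj km'.2 (jl.2.getD (e (some x)) 0) (jl.2.getD (e (some y)) 0) = true) ↔ _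
  rw [← (h9 x y).2]
  simp only [yB, Bool.or_eq_true, Bool.and_eq_true, hadj, bne_iff_ne, ne_eq, hinj, hss,
    triangleY_ns, Option.some.injEq]
  constructor
  · rintro (h | ⟨⟨h1, h2⟩, h3⟩)
    · exact h.1
    · rcases h2 with rfl | rfl | rfl <;> rcases h3 with rfl | rfl | rfl <;>
        first | exact absurd rfl h1 | assumption | (apply SimpleGraph.Adj.symm; assumption)
  · intro h
    have := h.ne
    tauto

lemma k6_iso : Nonempty ((⊤ : SimpleGraph (Fin 6)) ≃g gr 6 35235970478142) :=
  ⟨⟨Equiv.refl _, by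
    intro a b
    revert a b
    unfold gr
    decide⟩⟩

lemma fam_of_isPetersenFamily {V : Type} {G : SimpleGraph V} (h : IsPetersenFamily G) :
    Fam G := by
  induction h with
  | k6 => exact ⟨(6, 35235970478142), by simp [famL], k6_iso⟩
  | deltaY _ h1 h2 h3 ih => exact ih.deltaY h1 h2 h3
  | yDelta _ h1 h2 h3 ih => exact ih.yDelta h1 h2 h3
  | iso _ e ih => exact ih.iso e

def deg3 : Bool := famL.all fun km => (List.range km.1).all fun w =>
  (List.range km.1).any fun x => sadj km.2 w x && (List.range km.1).any fun y =>
    sadj km.2 w y && (x != y) && (List.range km.1).any fun z =>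
      sadj km.2 w z && (x != z) && (y != z)

lemma deg3_true : deg3 = true := by decide +kernel

lemma Fam.deg3 {V : Type} {G : SimpleGraph V} (h : Fam G) (w : V) :
    ∃ x y z, G.Adj w x ∧ G.Adj w y ∧ G.Adj w z ∧ x ≠ y ∧ x ≠ z ∧ y ≠ z := by
  obtain ⟨km, hm, ⟨e⟩⟩ := h
  have h := deg3_true
  simp only [_root_.deg3, List.all_eq_true, List.mem_range, List.any_eq_true, Bool.and_eq_true,
    bne_iff_ne] at h
  obtain ⟨x, hx, h1, y, hy, ⟨h2, hxy⟩, z, hz, ⟨h3, hxz⟩, hyz⟩ := h km hm (e w) (e w).2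
  have key : ∀ (x : ℕ) (hx : x < km.1), sadj km.2 (e w) x = true → G.Adj w (e.symm ⟨x, hx⟩) := by
    intro x hx h
    rw [← e.map_adj_iff]
    rw [RelIso.apply_symm_apply]
    exact h
  refine ⟨_, _, _, key x hx h1, key y hy h2, key z hz h3, ?_, ?_, ?_⟩ <;>
  · intro h
    have := congrArg Fin.val (e.symm.injective h)
    simp_all

/-! ### Part 2: weak minors -/

/-- `H` maps weakly into `G`: vertices go injectively to vertices, edges go to walks, and
disjoint edges go to walks with disjoint supports. -/
def WM {W V : Type} (H : SimpleGraph W) (G : SimpleGraph V) : Prop :=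
  ∃ r : W → V, Function.Injective r ∧ ∃ φ : ∀ u v, H.Adj u v → G.Walk (r u) (r v),
    ∀ u v x y (h : H.Adj u v) (h' : H.Adj x y), u ≠ x → u ≠ y → v ≠ x → v ≠ y →
      ∀ z ∈ (φ u v h).support, z ∉ (φ x y h').support

lemma walk_of_connected {V : Type} {G : SimpleGraph V} {S : Set V}
    (h : (G.induce S).Preconnected) {a b : V} (ha : a ∈ S) (hb : b ∈ S) :
    ∃ p : G.Walk a b, ∀ z ∈ p.support, z ∈ S := by
  obtain ⟨p⟩ := h ⟨a, ha⟩ ⟨b, hb⟩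
  refine ⟨p.map (SimpleGraph.Embedding.induce S).toHom, ?_⟩
  intro z hz
  have hz' := (SimpleGraph.Walk.support_map (SimpleGraph.Embedding.induce S).toHom p) ▸ hz
  rw [List.mem_map] at hz'
  obtain ⟨y, -, rfl⟩ := hz'
  exact y.2

lemma WM.of_isMinor {W V : Type} {H : SimpleGraph W} {G : SimpleGraph V} (h : IsMinor H G) :
    WM H G := by
  obtain ⟨f, hne, hconn, hdisj, hadj⟩ := h
  choose r hr using hne
  have hd : ∀ {w w' z}, z ∈ f w → z ∈ f w' → w = w' := by
    intro w w' z h1 h2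
    by_contra hw
    exact Set.disjoint_left.1 (hdisj hw) h1 h2
  have key : ∀ u v, H.Adj u v →
      ∃ p : G.Walk (r u) (r v), ∀ z ∈ p.support, z ∈ f u ∨ z ∈ f v := by
    intro u v h
    obtain ⟨a, ha, b, hb, hab⟩ := hadj h
    obtain ⟨p, hp⟩ := walk_of_connected (hconn u).preconnected (hr u) ha
    obtain ⟨q, hq⟩ := walk_of_connected (hconn v).preconnected hb (hr v)
    refine ⟨p.append (SimpleGraph.Walk.cons hab q), ?_⟩
    intro z hz
    rw [SimpleGraph.Walk.mem_support_append_iff, SimpleGraph.Walk.support_cons,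
      List.mem_cons] at hz
    rcases hz with hz | rfl | hz
    · exact Or.inl (hp z hz)
    · exact Or.inl ha
    · exact Or.inr (hq z hz)
  choose φ hφ using key
  refine ⟨r, ?_, φ, ?_⟩
  · intro a b hab
    exact hd (hr a) (hab ▸ hr b)
  · intro u v x y h h' h1 h2 h3 h4 z hz hz'
    rcases hφ _ _ h z hz with h5 | h5 <;> rcases hφ _ _ h' z hz' with h6 | h6
    · exact h1 (hd h5 h6)
    · exact h2 (hd h5 h6)
    · exact h3 (hd h5 h6)
    · exact h4 (hd h5 h6)

lemma WM.of_iso {W V : Type} {H : SimpleGraph W} {G : SimpleGraph V} (e : H ≃g G) : WM H G := by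
  refine ⟨e, e.injective, fun u v h => (e.map_adj_iff.2 h).toWalk, ?_⟩
  intro u v x y h h' h1 h2 h3 h4 z hz hz'
  simp only [SimpleGraph.Adj.toWalk, SimpleGraph.Walk.support_cons, SimpleGraph.Walk.support_nil,
    List.mem_cons, List.not_mem_nil, or_false] at hz hz'
  rcases hz with rfl | rfl <;> simp_all [e.injective.eq_iff]

lemma WM.triangleY {V : Type} (G : SimpleGraph V) {a b c : V} (hab : a ≠ b) (hbc : b ≠ c)
    (hac : a ≠ c) : WM G (triangleY G a b c) := by
  have key : ∀ u v, G.Adj u v →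
      ∃ p : (_root_.triangleY G a b c).Walk (some u) (some v), ∀ z ∈ p.support,
        z = some u ∨ z = some v ∨
          (z = none ∧ (u = a ∨ u = b ∨ u = c) ∧ (v = a ∨ v = b ∨ v = c)) := by
    intro u v h
    by_cases hT : (u = a ∨ u = b ∨ u = c) ∧ (v = a ∨ v = b ∨ v = c)
    · refine ⟨.cons ((triangleY_sn G a b c u).2 hT.1)
        (.cons ((triangleY_ns G a b c v).2 hT.2) .nil), ?_⟩
      intro z hz
      simp only [SimpleGraph.Walk.support_cons, SimpleGraph.Walk.support_nil,
        List.mem_cons, List.not_mem_nil, or_false] at hz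
      tauto
    · refine ⟨.cons ((triangleY_ss G hab hbc hac u v).2 ⟨h, hT⟩) .nil, ?_⟩
      intro z hz
      simp only [SimpleGraph.Walk.support_cons, SimpleGraph.Walk.support_nil,
        List.mem_cons, List.not_mem_nil, or_false] at hz
      tauto
  choose φ hφ using key
  refine ⟨some, Option.some_injective _, φ, ?_⟩
  intro u v x y h h' h1 h2 h3 h4 z hz hz'
  have h5 := hφ _ _ h z hz
  have h6 := hφ _ _ h' z hz'
  have := h.ne
  have := h'.ne
  rcases h5 with rfl | rfl | ⟨rfl, h7, h8⟩
  · simp_all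
  · simp_all
  · simp only [reduceCtorEq, false_or, true_and] at h6
    obtain ⟨h9, h10⟩ := h6
    rcases h7 with rfl | rfl | rfl <;> rcases h8 with rfl | rfl | rfl <;>
      rcases h9 with rfl | rfl | rfl <;> rcases h10 with rfl | rfl | rfl <;> simp_all

lemma WM.trans {U W V : Type} {K : SimpleGraph U} {H : SimpleGraph W} {G : SimpleGraph V}
    (h1 : WM K H) (h2 : WM H G) : WM K G := by
  obtain ⟨r, hr, φ, hφ⟩ := h1
  obtain ⟨s, hs, ψ, hψ⟩ := h2
  have key : ∀ {a b : W} (p : H.Walk a b), ∃ q : G.Walk (s a) (s b), ∀ z ∈ q.support,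
      (a = b ∧ p.support = [a]) ∨ ∃ x y, ∃ h : H.Adj x y, x ∈ p.support ∧ y ∈ p.support ∧
        z ∈ (ψ x y h).support := by
    intro a b p
    induction p with
    | nil => exact ⟨.nil, fun z _ => Or.inl ⟨rfl, rfl⟩⟩
    | @cons a b c h p ih =>
      obtain ⟨q, hq⟩ := ih
      by_cases hp : b = c ∧ p.support = [b]
      · obtain ⟨rfl, hp⟩ := hp
        refine ⟨ψ a b h, fun z hz => Or.inr ⟨a, b, h, ?_, ?_, hz⟩⟩ <;> simp
      · refine ⟨(ψ a b h).append q, ?_⟩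
        intro z hz
        rw [SimpleGraph.Walk.mem_support_append_iff] at hz
        right
        rcases hz with hz | hz
        · exact ⟨a, b, h, by simp, by simp, hz⟩
        · obtain ⟨x, y, h', hx, hy, hz⟩ := (hq z hz).resolve_left hp
          refine ⟨x, y, h', ?_, ?_, hz⟩
          · rw [SimpleGraph.Walk.support_cons]; exact List.mem_cons_of_mem _ hx
          · rw [SimpleGraph.Walk.support_cons]; exact List.mem_cons_of_mem _ hy
  have key2 : ∀ u v (h : K.Adj u v), ∃ q : G.Walk (s (r u)) (s (r v)), ∀ z ∈ q.support,
      ∃ x y, ∃ h' : H.Adj x y, x ∈ (φ u v h).support ∧ y ∈ (φ u v h).support ∧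
        z ∈ (ψ x y h').support := by
    intro u v h
    obtain ⟨q, hq⟩ := key (φ u v h)
    refine ⟨q, fun z hz => (hq z hz).resolve_left ?_⟩
    rintro ⟨h3, -⟩
    exact h.ne (hr h3)
  choose χ hχ using key2
  refine ⟨s ∘ r, hs.comp hr, χ, ?_⟩
  intro u v x y h h' h1 h2 h3 h4 z hz hz'
  obtain ⟨a, b, hab, ha, hb, hz⟩ := hχ _ _ h z hz
  obtain ⟨c, d, hcd, hc, hd, hz'⟩ := hχ _ _ h' z hz'
  have hd' := hφ u v x y h h' h1 h2 h3 h4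
  refine hψ a b c d hab hcd ?_ ?_ ?_ ?_ z hz hz'
  · rintro rfl; exact hd' _ ha hc
  · rintro rfl; exact hd' _ ha hd
  · rintro rfl; exact hd' _ hb hc
  · rintro rfl; exact hd' _ hb hd

/-- One explicit triangle-to-Y step between two coded graphs. -/
lemma step_iso {k m a b c m' : ℕ}
    (h : okD k m a b c m' (List.range (k + 1)) = true)
    (ha : a < k) (hb : b < k) (hc : c < k) (hab : sadj m a b = true) (hbc : sadj m b c = true)
    (hac : sadj m a c = true) :
    WM (gr k m) (gr (k + 1) m') ∧
      (IsPetersenFamily (gr k m) → IsPetersenFamily (gr (k + 1) m')) := by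
  have n1 : a ≠ b := by rintro rfl; simp [sadj] at hab
  have n2 : b ≠ c := by rintro rfl; simp [sadj] at hbc
  have n3 : a ≠ c := by rintro rfl; simp [sadj] at hac
  obtain ⟨e⟩ := okD_iso h ha hb hc n1 n2 n3
  refine ⟨WM.trans (WM.triangleY _ ?_ ?_ ?_) (WM.of_iso e), fun hG => ?_⟩
  · simpa using n1
  · simpa using n2
  · simpa using n3
  · have h1 : (gr k m).Adj ⟨a, ha⟩ ⟨b, hb⟩ := hab
    have h2 : (gr k m).Adj ⟨b, hb⟩ ⟨c, hc⟩ := hbc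
    have h3 : (gr k m).Adj ⟨a, ha⟩ ⟨c, hc⟩ := hac
    exact .iso (.deltaY hG h1 h2 h3) e

lemma step1 : WM (gr 6 35235970478142) (gr 7 35236037648504) ∧
    (IsPetersenFamily (gr 6 35235970478142) → IsPetersenFamily (gr 7 35236037648504)) :=
  step_iso (a := 0) (b := 1) (c := 2)
  (by decide +kernel) (by decide) (by decide) (by decide)
  (by decide +kernel) (by decide +kernel) (by decide +kernel)

lemma step2 : WM (gr 7 35236037648504) (gr 8 176093785088224) ∧
    (IsPetersenFamily (gr 7 35236037648504) → IsPetersenFamily (gr 8 176093785088224)) :=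
  step_iso (a := 0) (b := 3) (c := 4)
  (by decide +kernel) (by decide) (by decide) (by decide)
  (by decide +kernel) (by decide +kernel) (by decide +kernel)

lemma step3 : WM (gr 7 35236037648504) (gr 8 144256063129116792) ∧
    (IsPetersenFamily (gr 7 35236037648504) → IsPetersenFamily (gr 8 144256063129116792)) :=
  step_iso (a := 3) (b := 4) (c := 5)
  (by decide +kernel) (by decide) (by decide) (by decide)
  (by decide +kernel) (by decide +kernel) (by decide +kernel)

lemma step4 : WM (gr 8 176093785088224) (gr 9 288406710455189728) ∧
    (IsPetersenFamily (gr 8 176093785088224) → IsPetersenFamily (gr 9 288406710455189728)) :=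
  step_iso (a := 1) (b := 3) (c := 5)
  (by decide +kernel) (by decide) (by decide) (by decide)
  (by decide +kernel) (by decide +kernel) (by decide +kernel)

lemma step5 : WM (gr 9 288406710455189728) (gr 10 865395228826484960) ∧
    (IsPetersenFamily (gr 9 288406710455189728) → IsPetersenFamily (gr 10 865395228826484960)) :=
  step_iso (a := 2) (b := 4) (c := 5)
  (by decide +kernel) (by decide) (by decide) (by decide)
  (by decide +kernel) (by decide +kernel) (by decide +kernel)

lemma petersen_mem : IsPetersenFamily (gr 10 865395228826484960) := by
  obtain ⟨e⟩ := k6_iso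
  exact step5.2 (step4.2 (step2.2 (step1.2 (.iso .k6 e))))

lemma Fam.root {V : Type} {G : SimpleGraph V} (h : Fam G) :
    WM (gr 6 35235970478142) G ∨ WM (gr 7 120376639614) G := by
  obtain ⟨km, hm, ⟨e⟩⟩ := h
  have h6 := step1.1
  have h7 := h6.trans step2.1
  have h8 := h7.trans step4.1
  have hb := WM.of_iso e.symm
  simp only [famL, List.mem_cons, List.not_mem_nil, or_false] at hm
  rcases hm with rfl | rfl | rfl | rfl | rfl | rfl | rfl
  · exact Or.inl hb
  · exact Or.inl (h6.trans hb)
  · exact Or.inl (h7.trans hb)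
  · exact Or.inl ((h6.trans step3.1).trans hb)
  · exact Or.inl (h8.trans hb)
  · exact Or.inr hb
  · exact Or.inl ((h8.trans step5.1).trans hb)

/-! ### Part 3: the graph `Q` on 13 vertices and its linking form -/

def qadj (a b : ℕ) : Bool :=
  let d := (b + 13 - a) % 13
  d == 1 || d == 3 || d == 10 || d == 12

/-- The circulant graph on 13 vertices with connection set `{±1, ±3}`. -/
def Q : SimpleGraph (Fin 13) where
  Adj a b := qadj a b = true
  symm := ⟨by
    have h : ∀ a b : Fin 13, qadj a b = true → qadj b a = true := by decide +kernel
    exact h⟩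
  loopless := ⟨by
    have h : ∀ a : Fin 13, ¬ qadj a a = true := by decide +kernel
    exact h⟩

/-- For a convex drawing, does the edge `ab` cross over the edge `cd`? -/
def lB (a b c d : ℕ) : Bool :=
  Nat.blt (min c d) (min a b) && (Nat.blt (min a b) (max c d) && Nat.blt (max c d) (max a b))

def bz (b : Bool) : ZMod 2 := if b then 1 else 0

lemma bz_xor (a b : Bool) : bz (a ^^ b) = bz a + bz b := by
  revert a b; decide

def lZ (a b c d : Fin 13) : ZMod 2 := bz (lB a b c d)

def tZ (a b : Fin 13) : ZMod 2 := bz (Nat.blt a b)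

lemma lZ_symm1 (a b c d : Fin 13) : lZ a b c d = lZ b a c d := by
  simp only [lZ, lB, min_comm, max_comm]

lemma lZ_symm2 (a b c d : Fin 13) : lZ a b c d = lZ a b d c := by
  simp only [lZ, lB]
  rw [min_comm (c : ℕ), max_comm (c : ℕ)]

lemma tZ_symm {a b : Fin 13} (h : a ≠ b) : tZ a b + tZ b a = 1 := by
  revert a b; decide +kernel

lemma lZ_swap {a b c d : Fin 13} (h1 : a ≠ c) (h2 : a ≠ d) (h3 : b ≠ c) (h4 : b ≠ d)
    (h5 : a ≠ b) (h6 : c ≠ d) :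
    lZ a b c d + lZ c d a b = (tZ a c + tZ b c) + (tZ a d + tZ b d) := by
  have key : ∀ a b c d : Fin 13, (a == c || a == d || b == c || b == d || a == b || c == d ||
      ((lB a b c d ^^ lB c d a b) ==
        ((Nat.blt a c ^^ Nat.blt b c) ^^ (Nat.blt a d ^^ Nat.blt b d)))) = true := by
    decide +kernel
  have := key a b c d
  simp only [Bool.or_eq_true, beq_iff_eq, h1, h2, h3, h4, h5, h6, false_or] at this
  simp only [lZ, tZ, ← bz_xor, this]

/-- sum of a function over the edges of a walk -/
def S {V : Type} {G : SimpleGraph V} (f : V → V → ZMod 2) {u v : V} (p : G.Walk u v) : ZMod 2 :=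
  (p.darts.map fun d => f d.fst d.snd).sum

section S
variable {V : Type} {G : SimpleGraph V}

@[simp] lemma S_nil (f : V → V → ZMod 2) (u : V) : S f (.nil : G.Walk u u) = 0 := rfl

@[simp] lemma S_cons (f : V → V → ZMod 2) {u v w : V} (h : G.Adj u v) (p : G.Walk v w) :
    S f (.cons h p) = f u v + S f p := by
  simp [S]

lemma S_append (f : V → V → ZMod 2) {u v w : V} (p : G.Walk u v) (q : G.Walk v w) :
    S f (p.append q) = S f p + S f q := by
  simp [S]

lemma S_reverse (f : V → V → ZMod 2) (hf : ∀ a b, f a b = f b a) {u v : V} (p : G.Walk u v) :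
    S f p.reverse = S f p := by
  induction p with
  | nil => rfl
  | cons h p ih =>
    rw [SimpleGraph.Walk.reverse_cons, S_append, ih, S_cons, S_cons, S_nil, hf, add_comm, add_zero]

lemma S_add (f g : V → V → ZMod 2) {u v : V} (p : G.Walk u v) :
    S (fun a b => f a b + g a b) p = S f p + S g p := by
  induction p with
  | nil => simp
  | cons h p ih => simp only [S_cons, ih]; ring

lemma S_zero {u v : V} (p : G.Walk u v) : S (fun _ _ => 0) p = 0 := by
  induction p with
  | nil => simp
  | cons h p ih => simp only [S_cons, ih]; ring

lemma S_comm {V' : Type} {G' : SimpleGraph V'} (f : V → V → V' → V' → ZMod 2) {u v : V}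
    (p : G.Walk u v) {u' v' : V'} (q : G'.Walk u' v') :
    S (fun a b => S (fun c d => f a b c d) q) p = S (fun c d => S (fun a b => f a b c d) p) q := by
  induction p with
  | nil => simp [S_zero]
  | cons h p ih => simp only [S_cons, ih, S_add]

lemma S_congr {f g : V → V → ZMod 2} {u v : V} (p : G.Walk u v)
    (h : ∀ a b, G.Adj a b → a ∈ p.support → b ∈ p.support → f a b = g a b) : S f p = S g p := by
  induction p with
  | nil => simp
  | cons hh p ih =>
    simp only [S_cons]
    rw [h _ _ hh (by simp) (by simp), ih]
    intro a b hab ha hb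
    refine h a b hab ?_ ?_
    · rw [SimpleGraph.Walk.support_cons]; exact List.mem_cons_of_mem _ ha
    · rw [SimpleGraph.Walk.support_cons]; exact List.mem_cons_of_mem _ hb

lemma S_cob (g : V → ZMod 2) {u v : V} (p : G.Walk u v) :
    S (fun a b => g a + g b) p = g u + g v := by
  induction p with
  | nil => simp [CharTwo.add_self_eq_zero]
  | @cons u v w h p ih =>
    simp only [S_cons, ih]
    have := CharTwo.add_self_eq_zero (g v)
    linear_combination this

end S

/-- linking form of two walks -/
def Lw {u v x y : Fin 13} (p : Q.Walk u v) (q : Q.Walk x y) : ZMod 2 :=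
  S (fun a b => S (fun c d => lZ a b c d) q) p

lemma Lw_append_left {u v w x y : Fin 13} (p : Q.Walk u v) (p' : Q.Walk v w) (q : Q.Walk x y) :
    Lw (p.append p') q = Lw p q + Lw p' q := S_append _ _ _

lemma Lw_append_right {u v w x y : Fin 13} (p : Q.Walk u v) (p' : Q.Walk v w) (q : Q.Walk x y) :
    Lw q (p.append p') = Lw q p + Lw q p' := by
  unfold Lw
  simp only [S_append, S_add]

lemma Lw_reverse_left {u v x y : Fin 13} (p : Q.Walk u v) (q : Q.Walk x y) :
    Lw p.reverse q = Lw p q := by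
  refine S_reverse _ (fun a b => ?_) _
  simp only [lZ_symm1 a b]

lemma Lw_reverse_right {u v x y : Fin 13} (p : Q.Walk u v) (q : Q.Walk x y) :
    Lw p q.reverse = Lw p q := by
  unfold Lw
  congr 1
  funext a b
  refine S_reverse _ (fun c d => lZ_symm2 _ _ _ _) _

lemma Lw_swap {u v x y : Fin 13} (p : Q.Walk u v) (q : Q.Walk x y)
    (h : ∀ z ∈ p.support, z ∉ q.support) :
    Lw p q + Lw q p = (tZ u x + tZ v x) + (tZ u y + tZ v y) := by
  have h1 : Lw q p = S (fun a b => S (fun c d => lZ c d a b) q) p := by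
    unfold Lw
    rw [S_comm]
  rw [h1]
  unfold Lw
  rw [← S_add]
  have hn : ∀ a ∈ p.support, ∀ b ∈ q.support, a ≠ b := by
    rintro a ha b hb rfl
    exact h a ha hb
  have h2 : S (fun a b => S (fun c d => lZ a b c d) q + S (fun c d => lZ c d a b) q) p
      = S (fun a b => (tZ a x + tZ a y) + (tZ b x + tZ b y)) p := by
    apply S_congr
    intro a b hab ha hb
    rw [← S_add, S_congr (g := fun c d => (tZ a c + tZ b c) + (tZ a d + tZ b d)) q, S_cob]
    · ring
    · intro c d hcd hc hd
      exact lZ_swap (hn _ ha _ hc) (hn _ ha _ hd) (hn _ hb _ hc) (hn _ hb _ hd) hab.ne hcd.ne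
  rw [h2, S_cob (fun a => tZ a x + tZ a y)]
  ring

/-! the search through induced cycles -/

def eL : List (ℕ × ℕ) :=
  (List.range 13).map (fun i => (i, (i + 1) % 13)) ++ (List.range 13).map fun i => (i, (i + 3) % 13)

def rowL : List ℕ → ℕ → ℕ → Bool
  | [], _, _ => false
  | [_], _, _ => false
  | a :: b :: t, y, y' => lB a b y y' ^^ rowL (b :: t) y y'

def masks : List ℕ := [224, 0, 454, 56, 896, 799, 126, 2, 496, 510, 1138]

def leaf (u x : ℕ) (l : List ℕ) : Bool :=
  masks.any fun b => eL.all fun e => l.contains e.1 || (l.contains e.2 ||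
    ((lB x u e.1 e.2 ^^ rowL l e.1 e.2) == (b.testBit e.1 ^^ b.testBit e.2)))

def dfs : ℕ → ℕ → ℕ → List ℕ → Bool
  | 0, _, _, _ => false
  | f + 1, u, w, l => (List.range 13).all fun x => !qadj w x || ((w :: l).contains x ||
      bif l.any (qadj x) then !qadj x u || leaf u x (x :: w :: l) else dfs f u x (w :: l))

lemma dfs_true : ((List.range 13).all fun u => dfs 13 u u []) = true := by decide +kernel

/-! flatness -/

/-- `ρ` is a coboundary on the graph `Q` minus the vertices in `s` -/
def Good (s : Fin 13 → Prop) (ρ : Fin 13 → Fin 13 → ZMod 2) : Prop :=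
  ∃ b : Fin 13 → ZMod 2, ∀ y y', Q.Adj y y' → ¬ s y → ¬ s y' → ρ y y' = b y + b y'

lemma Good.add {s s1 s2 : Fin 13 → Prop} {ρ ρ1 ρ2 : Fin 13 → Fin 13 → ZMod 2}
    (h1 : Good s1 ρ1) (h2 : Good s2 ρ2) (hs1 : ∀ z, s1 z → s z) (hs2 : ∀ z, s2 z → s z)
    (hρ : ∀ y y', ρ y y' = ρ1 y y' + ρ2 y y') : Good s ρ := by
  obtain ⟨b1, hb1⟩ := h1
  obtain ⟨b2, hb2⟩ := h2
  refine ⟨fun y => b1 y + b2 y, fun y y' hy h h' => ?_⟩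
  rw [hρ, hb1 y y' hy (fun k => h (hs1 _ k)) (fun k => h' (hs1 _ k)),
    hb2 y y' hy (fun k => h (hs2 _ k)) (fun k => h' (hs2 _ k))]
  ring

/-- the row of the linking form belonging to a walk -/
def row {u v : Fin 13} (p : Q.Walk u v) (y y' : Fin 13) : ZMod 2 := S (fun a b => lZ a b y y') p

def GoodP {u v : Fin 13} (p r : Q.Walk u v) : Prop :=
  Good (fun z => z ∈ p.support ∨ z ∈ r.support) (fun y y' => row p y y' + row r y y')

lemma row_eq {u v : Fin 13} (p : Q.Walk u v) (y y' : Fin 13) :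
    row p y y' = bz (rowL (p.support.map Fin.val) y y') := by
  induction p with
  | nil => rfl
  | cons h p ih =>
    unfold row at ih ⊢
    rw [S_cons, ih, SimpleGraph.Walk.support_cons]
    rw [SimpleGraph.Walk.support_eq_cons p]
    simp only [List.map_cons, rowL, bz_xor, lZ]

lemma eL_of_adj : ∀ y y' : Fin 13, Q.Adj y y' →
    ((y : ℕ), (y' : ℕ)) ∈ eL ∨ ((y' : ℕ), (y : ℕ)) ∈ eL := by
  have h : ∀ y y' : Fin 13, (!qadj y y' || (eL.contains ((y : ℕ), (y' : ℕ)) ||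
    eL.contains ((y' : ℕ), (y : ℕ)))) = true := by decide +kernel
  intro y y' hy
  have h1 : qadj y y' = true := hy
  have := h y y'
  simpa [h1] using this

lemma row_symm {u v : Fin 13} (p : Q.Walk u v) (y y' : Fin 13) : row p y y' = row p y' y := by
  unfold row
  simp only [lZ_symm2 _ _ y y']

lemma leaf_good {w u x : Fin 13} (p : Q.Walk w u) (hwx : Q.Adj w x) (hxu : Q.Adj x u)
    (hl : leaf u x ((x : ℕ) :: (p.support.map Fin.val)) = true) :
    GoodP p (.cons hwx (.cons hxu .nil)) := by
  unfold leaf at hl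
  rw [List.any_eq_true] at hl
  obtain ⟨m, -, hm⟩ := hl
  rw [List.all_eq_true] at hm
  have hu : u ∈ p.support := p.end_mem_support
  have hw : w ∈ p.support := p.start_mem_support
  have key : ∀ y y' : Fin 13, ((y : ℕ), (y' : ℕ)) ∈ eL → ¬ (y = x ∨ y ∈ p.support) →
      ¬ (y' = x ∨ y' ∈ p.support) →
      row p y y' + row (.cons hwx (.cons hxu .nil)) y y'
        = bz (m.testBit y) + bz (m.testBit y') := by
    intro y y' hy h h'
    push Not at h h'
    have h1 := hm _ hy
    have e1 : ¬ (((x : ℕ) :: (p.support.map Fin.val)).contains (y : ℕ)) = true := by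
      simp only [List.contains_iff_mem, List.mem_cons, List.mem_map, Fin.val_inj, exists_eq_right]
      tauto
    have e2 : ¬ (((x : ℕ) :: (p.support.map Fin.val)).contains (y' : ℕ)) = true := by
      simp only [List.contains_iff_mem, List.mem_cons, List.mem_map, Fin.val_inj, exists_eq_right]
      tauto
    simp only [Bool.or_eq_true, e1, e2, Bool.false_eq_true, false_or, beq_iff_eq] at h1
    have h2 := congrArg bz h1
    simp only [bz_xor] at h2
    have h3 := row_eq (.cons hwx.symm p) y y'
    rw [SimpleGraph.Walk.support_cons, List.map_cons] at h3
    rw [← h3] at h2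
    rw [← h2]
    simp only [row, S_cons, S_nil, lZ_symm1 w x]
    unfold lZ
    ring
  refine ⟨fun y => bz (m.testBit y), fun y y' hy h h' => ?_⟩
  have k : ¬ (y = x ∨ y ∈ p.support) := by
    rintro (rfl | k)
    · exact h (by simp)
    · exact h (Or.inl k)
  have k' : ¬ (y' = x ∨ y' ∈ p.support) := by
    rintro (rfl | k)
    · exact h' (by simp)
    · exact h' (Or.inl k)
  rcases eL_of_adj y y' hy with h1 | h1
  · exact key y y' h1 k k'
  · show row p y y' + row (.cons hwx (.cons hxu .nil)) y y'
        = bz (m.testBit y) + bz (m.testBit y')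
    rw [row_symm p y y', row_symm _ y y', key y' y h1 k' k]
    ring

lemma flat_inner (M : ℕ)
    (IH : ∀ {w u : Fin 13} (p r : Q.Walk w u), p.length + r.length < M → GoodP p r) :
    ∀ {w u : Fin 13} (r p : Q.Walk w u) (f : ℕ), p.IsPath →
      (∀ y ∈ p.support.tail.tail, ¬ Q.Adj w y) → dfs f u w (p.support.tail.map Fin.val) = true →
      p.length + r.length = M → GoodP p r := by
  intro w u r
  induction r with
  | nil =>
    intro p f hp _ _ _
    rw [SimpleGraph.Walk.isPath_iff_eq_nil] at hp
    subst hp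
    exact ⟨fun _ => 0, fun y y' _ _ _ => by simp [row]⟩
  | @cons w x u hwx r' ih =>
    intro p f hp hch hd hM
    rw [SimpleGraph.Walk.length_cons] at hM
    by_cases hx : x ∈ p.support
    · have hspec := p.take_spec hx
      have hlen : (p.takeUntil x hx).length + (p.dropUntil x hx).length = p.length := by
        rw [← SimpleGraph.Walk.length_append, hspec]
      by_cases h0 : 1 ≤ (p.dropUntil x hx).length + r'.length
      · have g1 := IH (p.takeUntil x hx) (.cons hwx .nil) (by simp; omega)
        have g2 := IH (p.dropUntil x hx) r' (by omega)
        refine Good.add g1 g2 ?_ ?_ ?_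
        · rintro z (h | h)
          · exact Or.inl (p.support_takeUntil_subset_support hx h)
          · simp only [SimpleGraph.Walk.support_cons, SimpleGraph.Walk.support_nil,
              List.mem_cons, List.not_mem_nil, or_false] at h
            rcases h with rfl | rfl
            · exact Or.inl p.start_mem_support
            · exact Or.inl hx
        · rintro z (h | h)
          · exact Or.inl (p.support_dropUntil_subset_support hx h)
          · right
            rw [SimpleGraph.Walk.support_cons]
            exact List.mem_cons_of_mem _ h
        · intro y y'
          have e : row p y y' = row (p.takeUntil x hx) y y' + row (p.dropUntil x hx) y y' := by
            conv_lhs => rw [← hspec]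
            exact S_append _ _ _
          rw [e]
          simp only [row, S_cons, S_nil]
          ring
      · have hr : r'.length = 0 := by omega
        have hxu : x = u := SimpleGraph.Walk.eq_of_length_eq_zero hr
        subst hxu
        replace hr := (SimpleGraph.Walk.length_eq_zero_iff.1 hr).eq_nil
        subst hr
        cases p with
        | nil => exact absurd rfl hwx.ne
        | @cons _ v _ hwv p' =>
          have hpp := (SimpleGraph.Walk.cons_isPath_iff _ _).1 hp
          rw [SimpleGraph.Walk.support_cons, List.tail_cons] at hch
          have hvx : v = x := by
            have : x ∈ p'.support := p'.end_mem_support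
            rw [SimpleGraph.Walk.support_eq_cons, List.mem_cons] at this
            rcases this with h | h
            · exact h.symm
            · exact absurd hwx (hch x h)
          subst hvx
          have := (SimpleGraph.Walk.isPath_iff_eq_nil).1 hpp.1
          subst this
          exact ⟨fun _ => 0, fun y y' _ _ _ => by simp [row, CharTwo.add_self_eq_zero]⟩
    · cases f with
      | zero => simp [dfs] at hd
      | succ f =>
        unfold dfs at hd
        rw [List.all_eq_true] at hd
        have h1 := hd x (by simp)
        have hq : qadj w x = true := hwx
        have hlist : (w : ℕ) :: p.support.tail.map Fin.val = p.support.map Fin.val := by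
          conv_rhs => rw [SimpleGraph.Walk.support_eq_cons p, List.map_cons]
        have e1 : ¬ ((p.support.map Fin.val).contains (x : ℕ)) = true := by
          simp only [List.contains_iff_mem, List.mem_map, Fin.val_inj, exists_eq_right]
          exact hx
        rw [hlist] at h1
        simp only [Bool.or_eq_true, e1, false_or, hq, Bool.not_true, Bool.false_eq_true] at h1
        by_cases hc : ∃ y ∈ p.support.tail, Q.Adj x y
        · have hany : (List.any (p.support.tail.map Fin.val) (qadj x)) = true := by
            obtain ⟨y, hy, hxy⟩ := hc
            rw [List.any_eq_true]
            exact ⟨y, List.mem_map_of_mem hy, hxy⟩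
          rw [hany, cond_true, Bool.or_eq_true] at h1
          obtain ⟨y, hy, hxy⟩ := hc
          have hyp : y ∈ p.support := List.mem_of_mem_tail hy
          have hyw : w ≠ y := by
            rintro rfl
            have hnd := hp.support_nodup
            rw [SimpleGraph.Walk.support_eq_cons, List.nodup_cons] at hnd
            exact hnd.1 hy
          have hspec := p.take_spec hyp
          have hlen : (p.takeUntil y hyp).length + (p.dropUntil y hyp).length = p.length := by
            rw [← SimpleGraph.Walk.length_append, hspec]
          have ht : 1 ≤ (p.takeUntil y hyp).length := by
            by_contra hh
            exact hyw (SimpleGraph.Walk.eq_of_length_eq_zero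
              (p := p.takeUntil y hyp) (by omega))
          by_cases h0 : 2 ≤ (p.dropUntil y hyp).length + r'.length
          · have g1 := IH (p.takeUntil y hyp) (.cons hwx (.cons hxy .nil)) (by simp; omega)
            have g2 := IH (p.dropUntil y hyp) (.cons hxy.symm r') (by simp; omega)
            refine Good.add g1 g2 ?_ ?_ ?_
            · rintro z (h | h)
              · exact Or.inl (p.support_takeUntil_subset_support hyp h)
              · simp only [SimpleGraph.Walk.support_cons, SimpleGraph.Walk.support_nil,
                  List.mem_cons, List.not_mem_nil, or_false] at h
                rcases h with rfl | rfl | rfl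
                · exact Or.inl p.start_mem_support
                · right; simp
                · exact Or.inl hyp
            · rintro z (h | h)
              · exact Or.inl (p.support_dropUntil_subset_support hyp h)
              · rw [SimpleGraph.Walk.support_cons, List.mem_cons] at h
                rcases h with rfl | h
                · exact Or.inl hyp
                · right
                  rw [SimpleGraph.Walk.support_cons]
                  exact List.mem_cons_of_mem _ h
            · intro a a'
              have e : row p a a' = row (p.takeUntil y hyp) a a' + row (p.dropUntil y hyp) a a' := by
                conv_lhs => rw [← hspec]
                exact S_append _ _ _
              rw [e]
              simp only [row, S_cons, S_nil, lZ_symm1 y x]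
              have := CharTwo.add_self_eq_zero (lZ x y a a')
              linear_combination -this
          · have hr1 : 1 ≤ r'.length := by
              by_contra hh
              have := SimpleGraph.Walk.eq_of_length_eq_zero (p := r') (by omega)
              subst this
              exact hx p.end_mem_support
            cases r' with
            | nil => simp at hr1
            | @cons _ z _ hxz r'' =>
              rw [SimpleGraph.Walk.length_cons] at h0
              have hz : r''.length = 0 := by omega
              have hzu := SimpleGraph.Walk.eq_of_length_eq_zero hz
              subst hzu
              replace hz := (SimpleGraph.Walk.length_eq_zero_iff.1 hz).eq_nil
              subst hz
              have hq2 : qadj x z = true := hxz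
              rw [hq2] at h1
              simp only [Bool.not_true, Bool.false_eq_true, false_or] at h1
              exact leaf_good p hwx hxz h1
        · have hany : (List.any (p.support.tail.map Fin.val) (qadj x)) = false := by
            rw [Bool.eq_false_iff]
            intro h
            rw [List.any_eq_true] at h
            obtain ⟨k, hk, hk'⟩ := h
            rw [List.mem_map] at hk
            obtain ⟨y, hy, rfl⟩ := hk
            exact hc ⟨y, hy, hk'⟩
          rw [hany, cond_false] at h1
          have g := ih (.cons hwx.symm p) f (hp.cons hx) (by
            rw [SimpleGraph.Walk.support_cons, List.tail_cons]
            intro y hy hxy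
            exact hc ⟨y, hy, hxy⟩) (by
            rw [SimpleGraph.Walk.support_cons, List.tail_cons]
            exact h1) (by rw [SimpleGraph.Walk.length_cons]; omega)
          obtain ⟨b, hb⟩ := g
          refine ⟨b, fun y y' hy h h' => ?_⟩
          have tr : ∀ z, ¬ (z ∈ p.support ∨ z ∈ (SimpleGraph.Walk.cons hwx r').support) →
              ¬ (z ∈ (SimpleGraph.Walk.cons hwx.symm p).support ∨ z ∈ r'.support) := by
            rintro z hz (k | k)
            · rw [SimpleGraph.Walk.support_cons, List.mem_cons] at k
              rcases k with rfl | k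
              · exact hz (Or.inr (by simp))
              · exact hz (Or.inl k)
            · apply hz
              right
              rw [SimpleGraph.Walk.support_cons]
              exact List.mem_cons_of_mem _ k
          rw [← hb y y' hy (tr y h) (tr y' h')]
          simp only [row, S_cons, lZ_symm1 x w]
          ring

lemma goodP_all : ∀ (M : ℕ) {w u : Fin 13} (p r : Q.Walk w u), p.length + r.length = M →
    GoodP p r := by
  intro M
  induction M using Nat.strong_induction_on with
  | _ M IH =>
    intro w u p r hM
    have hd : dfs 13 u u [] = true := by
      have := dfs_true
      rw [List.all_eq_true] at this
      exact this u (by simp)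
    have g := flat_inner M (fun p r h => IH _ h p r rfl) (p.reverse.append r) .nil 13
      (by simp) (by simp) (by simpa using hd) (by simpa using hM)
    obtain ⟨b, hb⟩ := g
    refine ⟨b, fun y y' hy h h' => ?_⟩
    have tr : ∀ z, ¬ (z ∈ p.support ∨ z ∈ r.support) →
        ¬ (z ∈ (SimpleGraph.Walk.nil : Q.Walk u u).support ∨
          z ∈ (p.reverse.append r).support) := by
      rintro z hz (k | k)
      · rw [SimpleGraph.Walk.support_nil, List.mem_singleton] at k
        subst k
        exact hz (Or.inl p.end_mem_support)
      · rw [SimpleGraph.Walk.mem_support_append_iff, SimpleGraph.Walk.support_reverse,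
          List.mem_reverse] at k
        exact hz k
    rw [← hb y y' hy (tr y h) (tr y' h')]
    simp only [row, S_append, S_nil, zero_add]
    rw [S_reverse _ (fun a b => lZ_symm1 a b y y')]

lemma flat {u x : Fin 13} (p : Q.Walk u u) (q : Q.Walk x x)
    (h : ∀ z ∈ p.support, z ∉ q.support) : Lw p q = 0 := by
  obtain ⟨b, hb⟩ := goodP_all _ (.nil) p rfl
  unfold Lw
  rw [S_comm, S_congr (g := fun c d => b c + b d) q, S_cob, CharTwo.add_self_eq_zero]
  intro c d hcd hc hd
  have tr : ∀ z, z ∈ q.support → ¬ (z ∈ (SimpleGraph.Walk.nil : Q.Walk u u).support ∨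
      z ∈ p.support) := by
    rintro z hz (k | k)
    · rw [SimpleGraph.Walk.support_nil, List.mem_singleton] at k
      subst k
      exact h _ p.start_mem_support hz
    · exact h _ k hz
  rw [← hb c d hcd (tr c hc) (tr d hd)]
  simp [row]

/-! ### Part 5: `Q` is linkless -/

lemma ell_exists {k m : ℕ} (h : WM (gr k m) Q) :
    ∃ (l : Fin k → Fin k → Fin k → Fin k → ZMod 2) (t : Fin k → Fin k → ZMod 2),
      (∀ a b, a ≠ b → t a b + t b a = 1) ∧
      (∀ a b c d : Fin k, (sadj m a b && sadj m c d && a != c && a != d && b != c && b != d) = true →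
        l a b c d + l c d a b = (t a c + t b c) + (t a d + t b d)) ∧
      (∀ a b c x y z : Fin k, (sadj m a b && sadj m b c && sadj m a c &&
          sadj m x y && sadj m y z && sadj m x z &&
          a != x && a != y && a != z && b != x && b != y && b != z &&
          c != x && c != y && c != z) = true →
        (l a b x y + l a b y z + l a b x z) + (l b c x y + l b c y z + l b c x z)
          + (l a c x y + l a c y z + l a c x z) = 0) ∧
      (∀ a b c x y z w : Fin k, (sadj m a b && sadj m b c && sadj m a c &&
          sadj m x y && sadj m z y && sadj m z w && sadj m x w &&
          a != x && a != y && a != z && a != w && b != x && b != y && b != z && b != w &&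
          c != x && c != y && c != z && c != w) = true →
        (l a b x y + l a b z y + l a b z w + l a b x w)
          + (l b c x y + l b c z y + l b c z w + l b c x w)
          + (l a c x y + l a c z y + l a c z w + l a c x w) = 0) := by
  classical
  obtain ⟨r, hr, φ, hφ⟩ := h
  let l : Fin k → Fin k → Fin k → Fin k → ZMod 2 := fun a b c d =>
    if h : (gr k m).Adj a b ∧ (gr k m).Adj c d then Lw (φ a b h.1) (φ c d h.2) else 0
  have hl : ∀ {a b c d} (h1 : (gr k m).Adj a b) (h2 : (gr k m).Adj c d),
      l a b c d = Lw (φ a b h1) (φ c d h2) := fun h1 h2 => dif_pos ⟨h1, h2⟩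
  have hA : ∀ {a b : Fin k}, sadj m a b = true → (gr k m).Adj a b := fun h => h
  refine ⟨l, fun a b => tZ (r a) (r b), ?_, ?_, ?_, ?_⟩
  · intro a b hab
    exact tZ_symm (hr.ne hab)
  · intro a b c d h
    simp only [Bool.and_eq_true, bne_iff_ne] at h
    obtain ⟨⟨⟨⟨⟨h1, h2⟩, h3⟩, h4⟩, h5⟩, h6⟩ := h
    replace h1 := hA h1
    replace h2 := hA h2
    rw [hl h1 h2, hl h2 h1]
    exact Lw_swap _ _ (hφ _ _ _ _ h1 h2 h3 h4 h5 h6)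
  · intro a b c x y z h
    simp only [Bool.and_eq_true, bne_iff_ne] at h
    obtain ⟨⟨⟨⟨⟨⟨⟨⟨⟨⟨⟨⟨⟨⟨h1, h2⟩, h3⟩, h4⟩, h5⟩, h6⟩, n1⟩, n2⟩, n3⟩, n4⟩, n5⟩, n6⟩, n7⟩, n8⟩, n9⟩ := h
    replace h1 := hA h1
    replace h2 := hA h2
    replace h3 := hA h3
    replace h4 := hA h4
    replace h5 := hA h5
    replace h6 := hA h6
    have := flat (((φ a b h1).append (φ b c h2)).append (φ a c h3).reverse)
      (((φ x y h4).append (φ y z h5)).append (φ x z h6).reverse) (by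
        intro v hv hv'
        simp only [SimpleGraph.Walk.mem_support_append_iff, SimpleGraph.Walk.support_reverse,
          List.mem_reverse] at hv hv'
        rcases hv with (hv | hv) | hv <;> rcases hv' with (hv' | hv') | hv' <;>
          exact hφ _ _ _ _ _ _ (by assumption) (by assumption) (by assumption) (by assumption)
            v hv hv')
    simp only [Lw_append_left, Lw_append_right, Lw_reverse_left, Lw_reverse_right] at this
    simp only [hl h1 h4, hl h1 h5, hl h1 h6, hl h2 h4, hl h2 h5, hl h2 h6, hl h3 h4, hl h3 h5,
      hl h3 h6]
    linear_combination this
  · intro a b c x y z w h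
    simp only [Bool.and_eq_true, bne_iff_ne] at h
    obtain ⟨⟨⟨⟨⟨⟨⟨⟨⟨⟨⟨⟨⟨⟨⟨⟨⟨⟨h1, h2⟩, h3⟩, h4⟩, h5⟩, h6⟩, h7⟩, n1⟩, n2⟩, n3⟩, n4⟩, n5⟩, n6⟩, n7⟩,
      n8⟩, n9⟩, n10⟩, n11⟩, n12⟩ := h
    replace h1 := hA h1
    replace h2 := hA h2
    replace h3 := hA h3
    replace h4 := hA h4
    replace h5 := hA h5
    replace h6 := hA h6
    replace h7 := hA h7
    have := flat (((φ a b h1).append (φ b c h2)).append (φ a c h3).reverse)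
      ((((φ x y h4).append (φ z y h5).reverse).append (φ z w h6)).append (φ x w h7).reverse) (by
        intro v hv hv'
        simp only [SimpleGraph.Walk.mem_support_append_iff, SimpleGraph.Walk.support_reverse,
          List.mem_reverse] at hv hv'
        rcases hv with (hv | hv) | hv <;> rcases hv' with ((hv' | hv') | hv') | hv' <;>
          exact hφ _ _ _ _ _ _ (by assumption) (by assumption) (by assumption) (by assumption)
            v hv hv')
    simp only [Lw_append_left, Lw_append_right, Lw_reverse_left, Lw_reverse_right] at this
    simp only [hl h1 h4, hl h1 h5, hl h1 h6, hl h1 h7, hl h2 h4, hl h2 h5, hl h2 h6, hl h2 h7,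
      hl h3 h4, hl h3 h5, hl h3 h6, hl h3 h7]
    linear_combination this

lemma no_k6 : ¬ WM (gr 6 35235970478142) Q := by
  intro h
  obtain ⟨l, t, ts, sw, tt, tq⟩ := ell_exists h
  have h2 : (2 : ZMod 2) = 0 := rfl
  have h01 : (0 : ZMod 2) = 1 := by
    linear_combination
      tt 0 1 2 3 4 5 (by decide) + tt 0 1 3 2 4 5 (by decide) + tt 0 1 4 2 3 5 (by decide)
       + tt 0 1 5 2 3 4 (by decide) + tt 0 2 3 1 4 5 (by decide) + tt 0 2 4 1 3 5 (by decide)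
       + tt 0 2 5 1 3 4 (by decide) + tt 0 3 4 1 2 5 (by decide) + tt 0 3 5 1 2 4 (by decide)
       + tt 0 4 5 1 2 3 (by decide) + sw 1 2 3 4 (by decide) + sw 1 2 3 5 (by decide)
       + sw 1 2 4 5 (by decide) + sw 1 3 2 4 (by decide) + sw 1 3 2 5 (by decide)
       + sw 1 3 4 5 (by decide) + sw 1 4 2 3 (by decide) + sw 1 4 2 5 (by decide)
       + sw 1 4 3 5 (by decide) + sw 1 5 2 3 (by decide) + sw 1 5 2 4 (by decide)
       + sw 1 5 3 4 (by decide) + sw 2 3 4 5 (by decide) + sw 2 4 3 5 (by decide)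
       + sw 2 5 3 4 (by decide) + ts 4 3 (by decide) + ts 5 3 (by decide) + ts 5 4 (by decide)
      - h2 * (
      l 0 1 2 3 + l 0 1 2 4 + l 0 1 2 5 + l 0 1 3 4 + l 0 1 3 5 + l 0 1 4 5 + l 0 2 1 3
       + l 0 2 1 4 + l 0 2 1 5 + l 0 2 3 4 + l 0 2 3 5 + l 0 2 4 5 + l 0 3 1 2 + l 0 3 1 4
       + l 0 3 1 5 + l 0 3 2 4 + l 0 3 2 5 + l 0 3 4 5 + l 0 4 1 2 + l 0 4 1 3 + l 0 4 1 5
       + l 0 4 2 3 + l 0 4 2 5 + l 0 4 3 5 + l 0 5 1 2 + l 0 5 1 3 + l 0 5 1 4 + l 0 5 2 3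
       + l 0 5 2 4 + l 0 5 3 4 + l 1 2 3 4 + l 1 2 3 5 + l 1 2 4 5 + l 1 3 2 4 + l 1 3 2 5
       + l 1 3 4 5 + l 1 4 2 3 + l 1 4 2 5 + l 1 4 3 5 + l 1 5 2 3 + l 1 5 2 4 + l 1 5 3 4
       + l 2 3 1 4 + l 2 3 1 5 + l 2 3 4 5 + l 2 4 1 3 + l 2 4 1 5 + l 2 4 3 5 + l 2 5 1 3
       + l 2 5 1 4 + l 2 5 3 4 + l 3 4 1 2 + l 3 4 1 5 + l 3 4 2 5 + l 3 5 1 2 + l 3 5 1 4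
       + l 3 5 2 4 + l 4 5 1 2 + l 4 5 1 3 + l 4 5 2 3 + (-3) * t 1 2 + (-3) * t 1 3
       + (-3) * t 1 4 + (-3) * t 1 5 + (-2) * t 2 3 + (-2) * t 2 4 + (-2) * t 2 5 + (-1) * t 3 2
       + (-1) * t 3 4 + (-1) * t 3 5 + (-1) * t 4 2 + (-1) * t 4 3 + (-1) * t 4 5 + (-1) * t 5 2
       + (-1) * t 5 3 + (-1) * t 5 4 + (-1))
  exact absurd h01 (by decide)

lemma no_k331 : ¬ WM (gr 7 120376639614) Q := by
  intro h
  obtain ⟨l, t, ts, sw, tt, tq⟩ := ell_exists h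
  have h2 : (2 : ZMod 2) = 0 := rfl
  have h01 : (0 : ZMod 2) = 1 := by
    linear_combination
      tq 0 1 4 2 5 3 6 (by decide) + tq 0 1 5 2 4 3 6 (by decide) + tq 0 1 6 2 4 3 5 (by decide)
       + tq 0 2 4 1 5 3 6 (by decide) + tq 0 2 5 1 4 3 6 (by decide)
       + tq 0 2 6 1 4 3 5 (by decide) + tq 0 3 4 1 5 2 6 (by decide)
       + tq 0 3 5 1 4 2 6 (by decide) + tq 0 3 6 1 4 2 5 (by decide) + sw 1 4 2 5 (by decide)
       + sw 1 4 2 6 (by decide) + sw 1 4 3 5 (by decide) + sw 1 4 3 6 (by decide)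
       + sw 1 5 2 4 (by decide) + sw 1 5 2 6 (by decide) + sw 1 5 3 4 (by decide)
       + sw 1 5 3 6 (by decide) + sw 1 6 2 4 (by decide) + sw 1 6 2 5 (by decide)
       + sw 1 6 3 4 (by decide) + sw 1 6 3 5 (by decide) + sw 2 4 3 5 (by decide)
       + sw 2 4 3 6 (by decide) + sw 2 5 3 4 (by decide) + sw 2 5 3 6 (by decide)
       + sw 2 6 3 4 (by decide) + sw 2 6 3 5 (by decide) + ts 5 4 (by decide) + ts 6 4 (by decide)
       + ts 6 5 (by decide)
      - h2 * (
      l 0 1 2 4 + l 0 1 2 5 + l 0 1 2 6 + l 0 1 3 4 + l 0 1 3 5 + l 0 1 3 6 + l 0 2 1 4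
       + l 0 2 1 5 + l 0 2 1 6 + l 0 2 3 4 + l 0 2 3 5 + l 0 2 3 6 + l 0 3 1 4 + l 0 3 1 5
       + l 0 3 1 6 + l 0 3 2 4 + l 0 3 2 5 + l 0 3 2 6 + l 0 4 1 5 + l 0 4 1 6 + l 0 4 2 5
       + l 0 4 2 6 + l 0 4 3 5 + l 0 4 3 6 + l 0 5 1 4 + l 0 5 1 6 + l 0 5 2 4 + l 0 5 2 6
       + l 0 5 3 4 + l 0 5 3 6 + l 0 6 1 4 + l 0 6 1 5 + l 0 6 2 4 + l 0 6 2 5 + l 0 6 3 4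
       + l 0 6 3 5 + l 1 4 2 5 + l 1 4 2 6 + l 1 4 3 5 + l 1 4 3 6 + l 1 5 2 4 + l 1 5 2 6
       + l 1 5 3 4 + l 1 5 3 6 + l 1 6 2 4 + l 1 6 2 5 + l 1 6 3 4 + l 1 6 3 5 + l 2 4 1 5
       + l 2 4 1 6 + l 2 4 3 5 + l 2 4 3 6 + l 2 5 1 4 + l 2 5 1 6 + l 2 5 3 4 + l 2 5 3 6
       + l 2 6 1 4 + l 2 6 1 5 + l 2 6 3 4 + l 2 6 3 5 + l 3 4 1 5 + l 3 4 1 6 + l 3 4 2 5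
       + l 3 4 2 6 + l 3 5 1 4 + l 3 5 1 6 + l 3 5 2 4 + l 3 5 2 6 + l 3 6 1 4 + l 3 6 1 5
       + l 3 6 2 4 + l 3 6 2 5 + (-3) * t 1 2 + (-3) * t 1 3 + (-2) * t 1 4 + (-2) * t 1 5
       + (-2) * t 1 6 + (-3) * t 2 3 + (-1) * t 2 4 + (-1) * t 2 5 + (-1) * t 2 6 + (-1) * t 4 2
       + (-2) * t 4 3 + (-1) * t 4 5 + (-1) * t 4 6 + (-1) * t 5 2 + (-2) * t 5 3 + (-1) * t 5 4
       + (-1) * t 5 6 + (-1) * t 6 2 + (-2) * t 6 3 + (-1) * t 6 4 + (-1) * t 6 5 + (-1))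
  exact absurd h01 (by decide)

lemma Q_linkless : IsLinkless Q := by
  intro W P hP hm
  have h := WM.of_isMinor hm
  rcases (fam_of_isPetersenFamily hP).root with h1 | h1
  · exact no_k6 (h1.trans h)
  · exact no_k331 (h1.trans h)

/-! ### Part 6: `Q` is maximal linkless -/

/-- adjacency in `Q` with the edge `xy` added -/
def qadd (x y a b : ℕ) : Bool := qadj a b || ((a == x && b == y) || (a == y && b == x))

/-- branch sets (as a labelling of the vertices) and the centres of the branch sets -/
def cert (d : ℕ) : List ℕ × List ℕ :=
  if d == 2 then ([0,6,0,1,1,7,4,8,3,9,5,2,9], [0,3,11,8,6,10,1,5,7,9])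
  else if d == 4 then ([0,6,1,1,7,4,8,3,9,5,3,2,0], [0,2,11,7,5,9,1,4,6,8])
  else if d == 5 then ([0,0,6,1,1,7,4,8,3,9,5,3,2], [0,3,12,8,6,10,2,5,7,9])
  else ([0,0,1,1,6,8,5,2,3,9,2,7,4], [0,2,7,8,12,6,4,11,5,9])

def dd (x y : ℕ) : ℕ := (y + 13 - x) % 13

def labN (x y v : ℕ) : ℕ :=
  if dd x y ≤ 6 then (cert (dd x y)).1.getD ((v + 13 - x) % 13) 0
  else (cert (dd y x)).1.getD ((v + 13 - y) % 13) 0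

def cenN (x y w : ℕ) : ℕ :=
  if dd x y ≤ 6 then ((cert (dd x y)).2.getD w 0 + x) % 13
  else ((cert (dd y x)).2.getD w 0 + y) % 13

def ckCert (x y : ℕ) : Bool :=
  ((List.range 10).all fun w => labN x y (cenN x y w) == w) &&
  (((List.range 13).all fun v => v == cenN x y (labN x y v) ||
    qadd x y v (cenN x y (labN x y v))) &&
  (List.range 10).all fun w => (List.range 10).all fun w' => !sadj 865395228826484960 w w' ||
    (List.range 13).any fun v => labN x y v == w && (List.range 13).any fun v' =>
      labN x y v' == w' && qadd x y v v')

lemma ckCert_true : ((List.range 13).all fun x => (List.range 13).all fun y => x == y ||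
    (qadj x y || ckCert x y)) = true := by decide +kernel

lemma connected_star {V : Type} {G : SimpleGraph V} {s : Set V} {c : V} (hc : c ∈ s)
    (h : ∀ v ∈ s, v = c ∨ G.Adj v c) : (G.induce s).Connected := by
  have key : ∀ v : s, (G.induce s).Reachable v ⟨c, hc⟩ := by
    rintro ⟨v, hv⟩
    rcases h v hv with rfl | h1
    · exact SimpleGraph.Reachable.refl _
    · exact SimpleGraph.Adj.reachable (G := G.induce s) (u := ⟨v, hv⟩) (v := ⟨c, hc⟩) h1
  rw [SimpleGraph.connected_iff]
  exact ⟨fun a b => (key a).trans (key b).symm, ⟨⟨c, hc⟩⟩⟩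

lemma addEdge_adj {V : Type} (G : SimpleGraph V) {a b : V} (hab : a ≠ b) (u v : V) :
    (addEdge G a b).Adj u v ↔ G.Adj u v ∨ (u = a ∧ v = b) ∨ (u = b ∧ v = a) := by
  unfold addEdge
  rw [SimpleGraph.sup_adj, SimpleGraph.fromEdgeSet_adj, Set.mem_singleton_iff, Sym2.eq_iff]
  constructor
  · rintro (h | ⟨h, -⟩)
    · exact Or.inl h
    · exact Or.inr h
  · rintro (h | h)
    · exact Or.inl h
    · refine Or.inr ⟨h, ?_⟩
      rcases h with ⟨rfl, rfl⟩ | ⟨rfl, rfl⟩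
      · exact hab
      · exact hab.symm

lemma Q_petersen {x y : Fin 13} (hne : x ≠ y) (hxy : ¬ Q.Adj x y) :
    IsMinor (gr 10 865395228826484960) (addEdge Q x y) := by
  have hck : ckCert x y = true := by
    have h := ckCert_true
    simp only [List.all_eq_true, List.mem_range, Bool.or_eq_true, beq_iff_eq] at h
    rcases h x x.2 y y.2 with h | h | h
    · exact absurd (Fin.ext h) hne
    · exact absurd h hxy
    · exact h
  have hA : ∀ a b : Fin 13, qadd x y a b = true → (addEdge Q x y).Adj a b := by
    intro a b h
    rw [addEdge_adj _ hne]
    simp only [qadd, Bool.or_eq_true, Bool.and_eq_true, beq_iff_eq, Fin.val_inj] at h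
    exact h
  have hlt : ∀ w, cenN x y w < 13 := by
    intro w
    unfold cenN
    split <;> exact Nat.mod_lt _ (by norm_num)
  unfold ckCert at hck
  simp only [List.all_eq_true, List.any_eq_true, List.mem_range, Bool.or_eq_true,
    Bool.and_eq_true, beq_iff_eq, Bool.not_eq_true'] at hck
  obtain ⟨h1, h2, h3⟩ := hck
  refine ⟨fun w => {v | labN x y v = w}, ?_, ?_, ?_, ?_⟩
  · intro w
    exact ⟨⟨cenN x y w, hlt _⟩, h1 w w.2⟩
  · intro w
    refine connected_star (c := ⟨cenN x y w, hlt _⟩) (h1 w w.2) ?_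
    intro v hv
    have hv' : labN x y v = w := hv
    have := h2 v v.2
    rw [hv'] at this
    rcases this with h | h
    · left; exact Fin.ext h
    · right; exact hA _ _ h
  · intro w w' hw
    rw [Set.disjoint_left]
    intro v hv hv'
    exact hw (Fin.ext (hv.symm.trans hv'))
  · intro w w' hw
    have hw' : sadj 865395228826484960 w w' = true := hw
    rcases h3 w w.2 w' w'.2 with h | ⟨v, hv, hv1, v', hv', hv2, hvv⟩
    · rw [hw'] at h; exact absurd h (by decide)
    · exact ⟨⟨v, hv⟩, hv1, ⟨v', hv'⟩, hv2, hA _ _ hvv⟩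

lemma Q_maxnil : IsMaxnil Q :=
  ⟨Q_linkless, fun _ _ hne hxy h => h _ petersen_mem (Q_petersen hne hxy)⟩

/-! ### Part 7: adding vertices of degree two on edges -/

/-- `G` arises from `K` by adding vertices of degree two, attached to both ends of pairwise
distinct edges of `K`. -/
structure DegTwoExt {U V : Type} (K : SimpleGraph U) (G : SimpleGraph V) (ι : U → V) (A B : V → U) :
    Prop where
  inj : Function.Injective ι
  adj : ∀ x y, G.Adj (ι x) (ι y) ↔ K.Adj x y
  edge : ∀ v, (∀ x, v ≠ ι x) → K.Adj (A v) (B v)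
  nbr : ∀ v, (∀ x, v ≠ ι x) → ∀ z, G.Adj v z ↔ z = ι (A v) ∨ z = ι (B v)
  dist : ∀ v w, (∀ x, v ≠ ι x) → (∀ x, w ≠ ι x) → v ≠ w → s(A v, B v) ≠ s(A w, B w)
  tri : ∀ x y z, K.Adj x y → K.Adj y z → ¬ K.Adj x z

def VRep {U V : Type} (ι : U → V) (A B : V → U) (v : V) (x : U) : Prop :=
  v = ι x ∨ ((∀ y, v ≠ ι y) ∧ (x = A v ∨ x = B v))

section DegTwoExt
variable {U V : Type} {K : SimpleGraph U} {G : SimpleGraph V} {ι : U → V} {A B : V → U}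

lemma DegTwoExt.rep_rep (E : DegTwoExt K G ι A B) {v : V} {x y : U} (h : VRep ι A B v x)
    (h' : VRep ι A B v y) : x = y ∨ K.Adj x y := by
  rcases h with rfl | ⟨hv, h⟩
  · rcases h' with h' | ⟨hv, -⟩
    · exact Or.inl (E.inj h')
    · exact absurd rfl (hv x)
  · rcases h' with rfl | ⟨-, h'⟩
    · exact absurd rfl (hv y)
    · have := E.edge v hv
      have := this.symm
      rcases h with rfl | rfl <;> rcases h' with rfl | rfl <;> tauto

lemma DegTwoExt.rep_adj (E : DegTwoExt K G ι A B) {v w : V} {x y : U} (h : VRep ι A B v x)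
    (h' : VRep ι A B w y) (hvw : G.Adj v w) : x = y ∨ K.Adj x y := by
  by_cases hv : ∀ z, v ≠ ι z
  · rcases (E.nbr v hv w).1 hvw with rfl | rfl
    · have : y = A v := by
        rcases h' with h' | ⟨h', -⟩
        · exact (E.inj h').symm
        · exact absurd rfl (h' _)
      subst this
      exact E.rep_rep h (Or.inr ⟨hv, Or.inl rfl⟩)
    · have : y = B v := by
        rcases h' with h' | ⟨h', -⟩
        · exact (E.inj h').symm
        · exact absurd rfl (h' _)
      subst this
      exact E.rep_rep h (Or.inr ⟨hv, Or.inr rfl⟩)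
  · by_cases hw : ∀ z, w ≠ ι z
    · rcases (E.nbr w hw v).1 hvw.symm with rfl | rfl
      · have : x = A w := by
          rcases h with h | ⟨h, -⟩
          · exact (E.inj h).symm
          · exact absurd rfl (h _)
        subst this
        exact E.rep_rep (Or.inr ⟨hw, Or.inl rfl⟩) h'
      · have : x = B w := by
          rcases h with h | ⟨h, -⟩
          · exact (E.inj h).symm
          · exact absurd rfl (h _)
        subst this
        exact E.rep_rep (Or.inr ⟨hw, Or.inr rfl⟩) h'
    · rcases h with rfl | ⟨h, -⟩
      · rcases h' with rfl | ⟨h', -⟩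
        · exact Or.inr ((E.adj _ _).1 hvw)
        · exact absurd h' hw
      · exact absurd h hv

lemma DegTwoExt.minor_down (E : DegTwoExt K G ι A B) {W : Type} {P : SimpleGraph W}
    (hdeg : ∀ w, ∃ x y z, P.Adj w x ∧ P.Adj w y ∧ P.Adj w z ∧ x ≠ y ∧ x ≠ z ∧ y ≠ z)
    (hm : IsMinor P G) : IsMinor P K := by
  obtain ⟨f, hne, hconn, hdisj, hadj⟩ := hm
  have hd : ∀ {w w' z}, z ∈ f w → z ∈ f w' → w = w' := by
    intro w w' z h1 h2
    by_contra hw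
    exact Set.disjoint_left.1 (hdisj hw) h1 h2
  have hrep : ∀ w, ∀ v ∈ f w, ∃ x, ι x ∈ f w ∧ VRep ι A B v x := by
    intro w v hv
    by_cases hnew : ∀ z, v ≠ ι z
    · by_cases hA : ι (A v) ∈ f w
      · exact ⟨A v, hA, Or.inr ⟨hnew, Or.inl rfl⟩⟩
      by_cases hB : ι (B v) ∈ f w
      · exact ⟨B v, hB, Or.inr ⟨hnew, Or.inr rfl⟩⟩
      exfalso
      have hsing : ∀ u ∈ f w, u = v := by
        intro u hu
        obtain ⟨p⟩ := (hconn w).preconnected ⟨v, hv⟩ ⟨u, hu⟩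
        cases p with
        | nil => rfl
        | @cons _ z _ h _ =>
          exfalso
          have hz : G.Adj v z := h
          rcases (E.nbr v hnew z).1 hz with h1 | h1
          · exact hA (h1 ▸ z.2)
          · exact hB (h1 ▸ z.2)
      have hN : ∀ x, P.Adj w x → ι (A v) ∈ f x ∨ ι (B v) ∈ f x := by
        intro x hx
        obtain ⟨v1, h1, v2, h2, h12⟩ := hadj hx
        rw [hsing v1 h1] at h12
        rcases (E.nbr v hnew v2).1 h12 with rfl | rfl
        · exact Or.inl h2
        · exact Or.inr h2
      obtain ⟨x, y, z, hx, hy, hz, hxy, hxz, hyz⟩ := hdeg w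
      rcases hN x hx with h1 | h1 <;> rcases hN y hy with h2 | h2 <;>
        rcases hN z hz with h3 | h3 <;>
        first
          | exact hxy (hd h1 h2)
          | exact hxz (hd h1 h3)
          | exact hyz (hd h2 h3)
    · push Not at hnew
      obtain ⟨x, rfl⟩ := hnew
      exact ⟨x, hv, Or.inl rfl⟩
  choose g hg hgR using hrep
  have hgι : ∀ w x (hx : ι x ∈ f w), g w (ι x) hx = x := by
    intro w x hx
    rcases hgR w (ι x) hx with h | ⟨h, -⟩
    · exact (E.inj h).symm
    · exact absurd rfl (h x)
  refine ⟨fun w => ι ⁻¹' f w, ?_, ?_, ?_, ?_⟩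
  · intro w
    obtain ⟨v, hv⟩ := hne w
    exact ⟨g w v hv, hg w v hv⟩
  · intro w
    have key : ∀ a b : f w, (G.induce (f w)).Walk a b →
        (K.induce (ι ⁻¹' f w)).Reachable ⟨g w a a.2, hg w a a.2⟩ ⟨g w b b.2, hg w b b.2⟩ := by
      intro a b p
      induction p with
      | nil => exact SimpleGraph.Reachable.refl _
      | @cons a b c h p ih =>
        refine SimpleGraph.Reachable.trans ?_ ih
        have hab : G.Adj a b := h
        rcases E.rep_adj (hgR w a a.2) (hgR w b b.2) hab with h1 | h1
        · have : (⟨g w a a.2, hg w a a.2⟩ : (ι ⁻¹' f w : Set U)) = ⟨g w b b.2, hg w b b.2⟩ :=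
            Subtype.ext h1
          rw [this]
        · exact SimpleGraph.Adj.reachable (G := K.induce (ι ⁻¹' f w))
            (u := ⟨g w a a.2, hg w a a.2⟩) (v := ⟨g w b b.2, hg w b b.2⟩) h1
    rw [SimpleGraph.connected_iff]
    refine ⟨?_, ?_⟩
    · rintro ⟨x, hx⟩ ⟨y, hy⟩
      obtain ⟨p⟩ := (hconn w).preconnected ⟨ι x, hx⟩ ⟨ι y, hy⟩
      have := key _ _ p
      simpa only [hgι] using this
    · obtain ⟨v, hv⟩ := hne w
      exact ⟨⟨g w v hv, hg w v hv⟩⟩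
  · intro w w' hw
    rw [Set.disjoint_left]
    intro x h1 h2
    exact hw (hd h1 h2)
  · intro w w' hw
    obtain ⟨v1, h1, v2, h2, h12⟩ := hadj hw
    refine ⟨g w v1 h1, hg w v1 h1, g w' v2 h2, hg w' v2 h2, ?_⟩
    rcases E.rep_adj (hgR w v1 h1) (hgR w' v2 h2) h12 with h | h
    · exfalso
      have h3 := hg w v1 h1
      rw [h] at h3
      exact hw.ne (hd h3 (hg w' v2 h2))
    · exact h

lemma DegTwoExt.minor_up (E : DegTwoExt K G ι A B) {W : Type} {P : SimpleGraph W} {a b : V} {x y : U}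
    (hab : a ≠ b) (hxy : x ≠ y) (ha : VRep ι A B a x) (hb : VRep ι A B b y)
    (hm : IsMinor P (addEdge K x y)) : IsMinor P (addEdge G a b) := by
  obtain ⟨f, hne, hconn, hdisj, hadj⟩ := hm
  have hd : ∀ {w w' z}, z ∈ f w → z ∈ f w' → w = w' := by
    intro w w' z h1 h2
    by_contra hw
    exact Set.disjoint_left.1 (hdisj hw) h1 h2
  let T : V → U → Prop := fun v u => v = ι u ∨ (v = a ∧ u = x) ∨ (v = b ∧ u = y)
  have hTf : ∀ {v u u'}, T v u → T v u' → u = u' := by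
    intro v u u' h h'
    have e1 : ∀ {u x a}, VRep ι A B a x → a = ι u → u = x := by
      rintro u x a (h | ⟨h, -⟩) h'
      · exact E.inj (h'.symm.trans h)
      · exact absurd h' (h u)
    rcases h with h | ⟨h, k⟩ | ⟨h, k⟩ <;> rcases h' with h' | ⟨h', k'⟩ | ⟨h', k'⟩
    · exact E.inj (h.symm.trans h')
    · subst h' k'; exact e1 ha h
    · subst h' k'; exact e1 hb h
    · subst h k; exact (e1 ha h').symm
    · rw [k, k']
    · exact absurd (h.symm.trans h') hab
    · subst h k; exact (e1 hb h').symm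
    · exact absurd (h'.symm.trans h) hab
    · rw [k, k']
  have hRA : ∀ {v u}, VRep ι A B v u → v = ι u ∨ (addEdge G a b).Adj v (ι u) := by
    rintro v u (h | ⟨h, k⟩)
    · exact Or.inl h
    · right
      rw [addEdge_adj _ hab]
      left
      rw [E.nbr v h]
      rcases k with rfl | rfl
      · exact Or.inl rfl
      · exact Or.inr rfl
  have hTA : ∀ {v u}, T v u → v = ι u ∨ (addEdge G a b).Adj v (ι u) := by
    rintro v u (h | ⟨rfl, rfl⟩ | ⟨rfl, rfl⟩)
    · exact Or.inl h
    · exact hRA ha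
    · exact hRA hb
  refine ⟨fun w => {v | ∃ u ∈ f w, T v u}, ?_, ?_, ?_, ?_⟩
  · intro w
    obtain ⟨u, hu⟩ := hne w
    exact ⟨ι u, u, hu, Or.inl rfl⟩
  · intro w
    set F : Set V := {v | ∃ u ∈ f w, T v u} with hF
    have hι : ∀ u ∈ f w, ι u ∈ F := fun u hu => ⟨u, hu, Or.inl rfl⟩
    have r1 : ∀ v u (hv : T v u) (hu : u ∈ f w), ((addEdge G a b).induce F).Reachable
        ⟨v, ⟨u, hu, hv⟩⟩ ⟨ι u, hι u hu⟩ := by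
      intro v u hv hu
      rcases hTA hv with h | h
      · subst h
        exact SimpleGraph.Reachable.refl _
      · exact SimpleGraph.Adj.reachable (G := (addEdge G a b).induce F)
          (u := ⟨v, ⟨u, hu, hv⟩⟩) (v := ⟨ι u, hι u hu⟩) h
    have r2 : ∀ u u' (hu : u ∈ f w) (hu' : u' ∈ f w), (addEdge K x y).Adj u u' →
        ((addEdge G a b).induce F).Reachable ⟨ι u, hι u hu⟩ ⟨ι u', hι u' hu'⟩ := by
      intro u u' hu hu' h
      rw [addEdge_adj _ hxy] at h
      have hax : T a x := Or.inr (Or.inl ⟨rfl, rfl⟩)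
      have hby : T b y := Or.inr (Or.inr ⟨rfl, rfl⟩)
      rcases h with h | ⟨rfl, rfl⟩ | ⟨rfl, rfl⟩
      · refine SimpleGraph.Adj.reachable (G := (addEdge G a b).induce F)
          (u := ⟨ι u, hι u hu⟩) (v := ⟨ι u', hι u' hu'⟩) ?_
        show (addEdge G a b).Adj (ι u) (ι u')
        rw [addEdge_adj _ hab]
        exact Or.inl ((E.adj _ _).2 h)
      · refine (r1 a u hax hu).symm.trans (SimpleGraph.Reachable.trans ?_ (r1 b u' hby hu'))
        refine SimpleGraph.Adj.reachable (G := (addEdge G a b).induce F)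
          (u := ⟨a, _⟩) (v := ⟨b, _⟩) ?_
        show (addEdge G a b).Adj a b
        rw [addEdge_adj _ hab]
        exact Or.inr (Or.inl ⟨rfl, rfl⟩)
      · refine (r1 b u hby hu).symm.trans (SimpleGraph.Reachable.trans ?_ (r1 a u' hax hu'))
        refine SimpleGraph.Adj.reachable (G := (addEdge G a b).induce F)
          (u := ⟨b, _⟩) (v := ⟨a, _⟩) ?_
        show (addEdge G a b).Adj b a
        rw [addEdge_adj _ hab]
        exact Or.inr (Or.inr ⟨rfl, rfl⟩)
    have r3 : ∀ u u' : f w, ((addEdge K x y).induce (f w)).Walk u u' →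
        ((addEdge G a b).induce F).Reachable ⟨ι u, hι u u.2⟩ ⟨ι u', hι u' u'.2⟩ := by
      intro u u' p
      induction p with
      | nil => exact SimpleGraph.Reachable.refl _
      | @cons u v z h p ih => exact (r2 u v u.2 v.2 h).trans ih
    rw [SimpleGraph.connected_iff]
    refine ⟨?_, ?_⟩
    · rintro ⟨v, u, hu, hv⟩ ⟨v', u', hu', hv'⟩
      obtain ⟨p⟩ := (hconn w).preconnected ⟨u, hu⟩ ⟨u', hu'⟩
      exact ((r1 v u hv hu).trans (r3 _ _ p)).trans (r1 v' u' hv' hu').symm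
    · obtain ⟨u, hu⟩ := hne w
      exact ⟨⟨ι u, hι u hu⟩⟩
  · intro w w' hw
    rw [Set.disjoint_left]
    rintro v ⟨u, hu, h⟩ ⟨u', hu', h'⟩
    rw [hTf h h'] at hu
    exact hw (hd hu hu')
  · intro w w' hw
    obtain ⟨u, hu, u', hu', h⟩ := hadj hw
    rw [addEdge_adj _ hxy] at h
    rcases h with h | ⟨rfl, rfl⟩ | ⟨rfl, rfl⟩
    · refine ⟨ι u, ⟨u, hu, Or.inl rfl⟩, ι u', ⟨u', hu', Or.inl rfl⟩, ?_⟩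
      rw [addEdge_adj _ hab]
      exact Or.inl ((E.adj _ _).2 h)
    · refine ⟨a, ⟨u, hu, Or.inr (Or.inl ⟨rfl, rfl⟩)⟩, b, ⟨u', hu', Or.inr (Or.inr ⟨rfl, rfl⟩)⟩, ?_⟩
      rw [addEdge_adj _ hab]
      exact Or.inr (Or.inl ⟨rfl, rfl⟩)
    · refine ⟨b, ⟨u, hu, Or.inr (Or.inr ⟨rfl, rfl⟩)⟩, a, ⟨u', hu', Or.inr (Or.inl ⟨rfl, rfl⟩)⟩, ?_⟩
      rw [addEdge_adj _ hab]
      exact Or.inr (Or.inr ⟨rfl, rfl⟩)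

lemma DegTwoExt.exists_rep (E : DegTwoExt K G ι A B) {a b : V} (hab : a ≠ b) (hn : ¬ G.Adj a b) :
    ∃ x y, VRep ι A B a x ∧ VRep ι A B b y ∧ x ≠ y ∧ ¬ K.Adj x y := by
  have half : ∀ {a b : V}, ¬ G.Adj a b → (∀ z, a ≠ ι z) → ∀ {y}, b = ι y →
      ∃ x, VRep ι A B a x ∧ x ≠ y ∧ ¬ K.Adj x y := by
    rintro a b hn ha y rfl
    rw [E.nbr a ha] at hn
    push Not at hn
    by_cases h : K.Adj (A a) y
    · refine ⟨B a, Or.inr ⟨ha, Or.inr rfl⟩, fun h' => hn.2 (by rw [h']), ?_⟩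
      exact E.tri _ _ _ (E.edge a ha).symm h
    · exact ⟨A a, Or.inr ⟨ha, Or.inl rfl⟩, fun h' => hn.1 (by rw [h']), h⟩
  by_cases ha : ∀ z, a ≠ ι z
  · by_cases hb : ∀ z, b ≠ ι z
    · have hd := E.dist a b ha hb hab
      have h1 := E.edge a ha
      have h2 := E.edge b hb
      have RA : VRep ι A B a (A a) := Or.inr ⟨ha, Or.inl rfl⟩
      have RB : VRep ι A B a (B a) := Or.inr ⟨ha, Or.inr rfl⟩
      have RA' : VRep ι A B b (A b) := Or.inr ⟨hb, Or.inl rfl⟩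
      have RB' : VRep ι A B b (B b) := Or.inr ⟨hb, Or.inr rfl⟩
      have gen : ∀ p q r s : U, K.Adj p q → K.Adj r s → s(p, q) ≠ s(r, s) → p = r →
          q ≠ s ∧ ¬ K.Adj q s := by
        rintro p q r s hpq hrs hd rfl
        exact ⟨fun h => hd (by rw [h]), E.tri _ _ _ hpq.symm hrs⟩
      by_cases k1 : A a = A b
      · exact ⟨_, _, RB, RB', gen _ _ _ _ h1 h2 hd k1⟩
      by_cases k2 : A a = B b
      · exact ⟨_, _, RB, RA', gen _ _ _ _ h1 h2.symm (by rwa [Sym2.eq_swap (a := B b)]) k2⟩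
      by_cases k3 : K.Adj (A a) (A b)
      · exact ⟨_, _, RA, RB', k2, fun k4 => E.tri _ _ _ k3 h2 k4⟩
      · exact ⟨_, _, RA, RA', k1, k3⟩
    · push Not at hb
      obtain ⟨y, rfl⟩ := hb
      obtain ⟨x, h1, h2, h3⟩ := half hn ha rfl
      exact ⟨x, y, h1, Or.inl rfl, h2, h3⟩
  · push Not at ha
    obtain ⟨x, rfl⟩ := ha
    by_cases hb : ∀ z, b ≠ ι z
    · obtain ⟨y, h1, h2, h3⟩ := half (fun h => hn h.symm) hb rfl
      exact ⟨x, y, Or.inl rfl, h1, h2.symm, fun h => h3 h.symm⟩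
    · push Not at hb
      obtain ⟨y, rfl⟩ := hb
      exact ⟨x, y, Or.inl rfl, Or.inl rfl, fun h => hab (by rw [h]),
        fun h => hn ((E.adj _ _).2 h)⟩

lemma DegTwoExt.isMaxnil (E : DegTwoExt K G ι A B) (h : IsMaxnil K) : IsMaxnil G := by
  refine ⟨?_, ?_⟩
  · intro W P hP hm
    exact h.1 P hP (E.minor_down (fam_of_isPetersenFamily hP).deg3 hm)
  · intro a b hab hn hL
    obtain ⟨x, y, hx, hy, hxy, hnxy⟩ := E.exists_rep hab hn
    refine h.2 x y hxy hnxy ?_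
    intro W P hP hm
    exact hL P hP (E.minor_up hab hxy hx hy hm)

end DegTwoExt

/-! ### Part 8: the graphs on `n` vertices -/

def eA (k : ℕ) : ℕ := (k - 13) % 13

def eB (k : ℕ) : ℕ := if k < 26 then (k - 12) % 13 else (k - 23) % 13

def gadj (a b : ℕ) : Bool :=
  if a < 13 then (if b < 13 then qadj a b else (a == eA b || a == eB b))
  else (if b < 13 then (b == eA a || b == eB a) else false)

lemma gadj_symm (a b : ℕ) (h : gadj a b = true) : gadj b a = true := by
  unfold gadj at h ⊢
  by_cases ha : a < 13 <;> by_cases hb : b < 13 <;> simp only [ha, hb, if_true, if_false] at h ⊢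
  · have : Q.Adj ⟨a, ha⟩ ⟨b, hb⟩ := h
    exact this.symm
  · exact h
  · exact h
  · exact h

lemma gadj_irrefl (a : ℕ) : ¬ gadj a a = true := by
  intro h
  unfold gadj at h
  by_cases ha : a < 13 <;> simp only [ha, if_true, if_false] at h
  · have : Q.Adj ⟨a, ha⟩ ⟨a, ha⟩ := h
    exact this.ne rfl
  · exact absurd h (by decide)

/-- The circulant graph `Q` together with `n - 13` vertices of degree two. -/
def Gn (n : ℕ) : SimpleGraph (Fin n) where
  Adj a b := gadj a b = true
  symm := ⟨fun a b h => gadj_symm a b h⟩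
  loopless := ⟨fun a h => gadj_irrefl a h⟩

instance (n : ℕ) : DecidableRel (Gn n).Adj := fun a b => inferInstanceAs (Decidable (gadj a b = true))

lemma eA_lt (k : ℕ) : eA k < 13 := Nat.mod_lt _ (by norm_num)

lemma eB_lt (k : ℕ) : eB k < 13 := by
  unfold eB
  split <;> exact Nat.mod_lt _ (by norm_num)

lemma eAB_edge : ∀ k : Fin 39, 13 ≤ (k : ℕ) → qadj (eA k) (eB k) = true := by decide +kernel

lemma eAB_dist : ∀ k l : Fin 39, (Nat.blt k 13 || Nat.blt l 13 || k == l ||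
    !((eA k == eA l && eB k == eB l) || (eA k == eB l && eB k == eA l))) = true := by
  decide +kernel

lemma Q_tri : ∀ x y z : Fin 13, (!qadj x y || !qadj y z || !qadj x z) = true := by decide +kernel

lemma Gn_ext {n : ℕ} (hn : 13 ≤ n) (hn' : n ≤ 39) :
    DegTwoExt Q (Gn n) (Fin.castLE hn) (fun v => ⟨eA v, eA_lt v⟩) (fun v => ⟨eB v, eB_lt v⟩) := by
  have hnew : ∀ v : Fin n, (∀ x, v ≠ Fin.castLE hn x) → ¬ (v : ℕ) < 13 := by
    intro v hv h
    exact hv ⟨v, h⟩ (Fin.ext rfl)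
  refine ⟨Fin.castLE_injective hn, ?_, ?_, ?_, ?_, ?_⟩
  · intro x y
    show gadj x y = true ↔ qadj x y = true
    unfold gadj
    rw [if_pos x.2, if_pos y.2]
  · intro v hv
    exact eAB_edge ⟨v, by omega⟩ (by have := hnew v hv; simp; omega)
  · intro v hv z
    have h1 := hnew v hv
    show gadj v z = true ↔ _
    unfold gadj
    rw [if_neg h1]
    have := eA_lt v
    have := eB_lt v
    by_cases hz : (z : ℕ) < 13
    · rw [if_pos hz]
      simp only [Bool.or_eq_true, beq_iff_eq, Fin.ext_iff, Fin.val_castLE]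
    · rw [if_neg hz]
      simp only [Fin.ext_iff, Fin.val_castLE, Bool.false_eq_true, false_iff]
      omega
  · intro v w hv hw hvw h
    have h1 := hnew v hv
    have h2 := hnew w hw
    have h3 := eAB_dist ⟨v, by omega⟩ ⟨w, by omega⟩
    rw [Sym2.eq_iff] at h
    simp only [Fin.mk.injEq] at h
    have e1 : Nat.blt v 13 = false := by
      rw [Bool.eq_false_iff]; intro h; exact h1 (Nat.le_of_ble_eq_true h)
    have e2 : Nat.blt w 13 = false := by
      rw [Bool.eq_false_iff]; intro h; exact h2 (Nat.le_of_ble_eq_true h)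
    simp only [e1, e2, Bool.or_eq_true, Bool.false_eq_true, false_or, beq_iff_eq, Fin.mk.injEq,
      Bool.not_eq_true', Bool.or_eq_false_iff, Bool.and_eq_false_iff, beq_eq_false_iff_ne] at h3
    rcases h3 with h3 | ⟨h3, h4⟩
    · exact hvw (Fin.ext h3)
    · tauto
  · intro x y z h1 h2 h3
    have := Q_tri x y z
    have k1 : qadj x y = true := h1
    have k2 : qadj y z = true := h2
    have k3 : qadj x z = true := h3
    rw [k1, k2, k3] at this
    exact absurd this (by decide)

lemma Gn_degrees (n : ℕ) (hn : 13 ≤ n) (hn' : n ≤ 39) :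
    (∑ v ∈ Finset.range n, ∑ w ∈ Finset.range n, bif gadj v w then 1 else 0) = 4 * n := by
  have h : ((List.range 40).all fun n => Nat.blt n 13 ||
    (∑ v ∈ Finset.range n, ∑ w ∈ Finset.range n, bif gadj v w then 1 else 0) == 4 * n) = true := by
    decide +kernel
  rw [List.all_eq_true] at h
  have h1 := h n (by simp; omega)
  rw [Bool.or_eq_true, beq_iff_eq] at h1
  rcases h1 with h1 | h1
  · have : n < 13 := Nat.le_of_ble_eq_true h1
    omega
  · exact h1

lemma Gn_card (n : ℕ) (hn : 13 ≤ n) (hn' : n ≤ 39) : (Gn n).edgeSet.ncard = 2 * n := by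
  rw [← SimpleGraph.coe_edgeFinset, Set.ncard_coe_finset]
  have h1 := (Gn n).sum_degrees_eq_twice_card_edges
  have h2 : ∑ v, (Gn n).degree v = 4 * n := by
    rw [← Gn_degrees n hn hn',
      ← Fin.sum_univ_eq_sum_range (fun v => ∑ w ∈ Finset.range n, bif gadj v w then 1 else 0) n]
    refine Finset.sum_congr rfl fun v _ => ?_
    rw [← Fin.sum_univ_eq_sum_range (fun w => bif gadj v w then 1 else 0) n,
      ← SimpleGraph.card_neighborFinset_eq_degree, SimpleGraph.neighborFinset_eq_filter,
      Finset.card_filter]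
    refine Finset.sum_congr rfl fun w _ => ?_
    show (if gadj v w = true then 1 else 0) = _
    cases gadj v w <;> rfl
  omega

/-- For every `n` with `13 ≤ n ≤ 39` there exists a maxnil graph with `n` vertices
and exactly `2n` edges. -/
theorem stmt_1 (n : ℕ) (hn : 13 ≤ n) (hn' : n ≤ 39) :
    ∃ G : SimpleGraph (Fin n), IsMaxnil G ∧ G.edgeSet.ncard = 2 * n := by
  exact ⟨Gn n, (Gn_ext hn hn').isMaxnil Q_maxnil, Gn_card n hn hn'⟩
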